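/- arXiv:2510.04873 — 2 statements merged into one kernel-verified Lean document; each statement's English description precedes it below -/
import Mathlib

section
/- Proposition 7.7 (residues at s = 3/4): For every nonzero integer n, the Dirichlet series Z_even(s) := Σ_{even c>0} S(n,0,c,ν_Θ³)·c^{−2s} and Z_odd(s) := Σ_{odd c̃>0} S(n,0,c̃,ν_Θ³)·c̃^{−2s} converge absolutely for every real s > 3/4, and: if n = −m² for some positive integer m, then lim_{s→3/4⁺} (s − 3/4)·Z_even(s) = e(−1/8)·2/π² and lim_{s→3/4⁺} (s − 3/4)·Z_odd(s) = e(3/8)·2/π²; for every other nonzero n, both limits equal 0. -/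
open Complex Real Filter Topology BigOperators MeasureTheory

noncomputable section

/-- `ee x = exp(2πix)`. -/
def ee (x : ℂ) : ℂ := Complex.exp (2 * (π : ℂ) * Complex.I * x)

/-- `ε_d`: equals 1 if `d ≡ 1 (mod 4)` and `i` if `d ≡ 3 (mod 4)`. -/
def epsFactor (d : ℕ) : ℂ := if d % 4 = 1 then 1 else Complex.I

/-- Weight-`w/2` Kloosterman sum with theta multiplier, even modulus `c`:
`S(m,n,c,ν_Θ^w) = Σ_d ε_d^w (2c/d)^w e((m a_d + n d)/(2c))`, the sum over `0 < d < 2c`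
with `gcd(d,2c)=1` and `a_d` the inverse of `d` modulo `2c` in `(0,2c)`. -/
def SKe (m n : ℤ) (c : ℕ) (w : ℕ) : ℂ :=
  ∑ d ∈ Finset.Ico 1 (2 * c), ∑ a ∈ Finset.Ico 1 (2 * c),
    if (a * d) % (2 * c) = 1 then
      epsFactor d ^ w * ((jacobiSym (2 * (c : ℤ)) d : ℤ) : ℂ) ^ w *
        ee (((m * a + n * d : ℤ) : ℂ) / (2 * (c : ℕ)))
    else 0

/-- Weight-`w/2` Kloosterman sum with theta multiplier, odd modulus `c`:
`S(m,n,c,ν_Θ^w) = e(w/8) ε_c^{-w} Σ_d (2d/c)^w e((m a_d + n d)/(2c))`, the sum over even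
`0 ≤ d < 2c` with `gcd(d,c)=1` and `a_d` the unique even inverse of `d` mod `c` in `[0,2c)`. -/
def SKo (m n : ℤ) (c : ℕ) (w : ℕ) : ℂ :=
  ee ((w : ℂ) / 8) * (epsFactor c)⁻¹ ^ w *
    ∑ d ∈ Finset.range (2 * c), ∑ a ∈ Finset.range (2 * c),
      if d % 2 = 0 ∧ a % 2 = 0 ∧ (a * d) % c = 1 % c then
        ((jacobiSym (2 * (d : ℤ)) c : ℤ) : ℂ) ^ w *
          ee (((m * a + n * d : ℤ) : ℂ) / (2 * (c : ℕ)))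
      else 0


/-- The Kloosterman–Selberg zeta function `Z_even(s) = Σ_{even c>0} S(n,0,c,ν_Θ³) c^{−2s}`. -/
def Zeven (n : ℤ) (s : ℝ) : ℂ :=
  ∑' c : ℕ, if Even c ∧ 0 < c then SKe n 0 c 3 * (((c : ℝ) ^ (-2 * s) : ℝ) : ℂ) else 0

/-- The Kloosterman–Selberg zeta function `Z_odd(s) = Σ_{odd c̃>0} S(n,0,c̃,ν_Θ³) c̃^{−2s}`. -/
def Zodd (n : ℤ) (s : ℝ) : ℂ :=
  ∑' c : ℕ, if Odd c then SKo n 0 c 3 * (((c : ℝ) ^ (-2 * s) : ℝ) : ℂ) else 0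

lemma summable_exp_neg_mul_int_sq {t : ℝ} (ht : 0 < t) :
    Summable fun n : ℤ => Real.exp (-π * t * n ^ 2) := by
  refine (summable_pow_mul_jacobiTheta₂_term_bound 0 ht 0).congr fun n => ?_
  simp [mul_assoc]

/-- Poisson summation along an arithmetic progression, as the parameter tends to `0` inside a
horocycle. -/
lemma tendsto_theta_progression {ι : Type*} {l : Filter ι} [l.IsCountablyGenerated] {z : ι → ℂ}
    (hz : ∀ i, 0 < (z i).re) (hlim : Tendsto (fun i => ((z i)⁻¹).re) l atTop)
    {b : ℕ} (hb : 0 < b) (r : ℤ) :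
    Tendsto (fun i => z i ^ (1 / 2 : ℂ) * ∑' n : ℤ, cexp (-π * z i * ((b * n + r : ℤ) : ℂ) ^ 2)) l
      (𝓝 (1 / b)) := by
  have hbR : (0 : ℝ) < b := by exact_mod_cast hb
  have hbC : (b : ℂ) ≠ 0 := by exact_mod_cast hb.ne'
  have hz0 : ∀ i, z i ≠ 0 := fun i h => by have := hz i; simp [h] at this
  have key : ∀ i, z i ^ (1 / 2 : ℂ) * ∑' n : ℤ, cexp (-π * z i * ((b * n + r : ℤ) : ℂ) ^ 2) =
      1 / b * ∑' n : ℤ, cexp (-π * n ^ 2 / (z i * b ^ 2) + 2 * π * I * n * r / b) := by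
    intro i
    have hre : 0 < (z i * ((b : ℝ) ^ 2 : ℝ)).re := by
      rw [re_mul_ofReal]; have := hz i; positivity
    have hP := Complex.tsum_exp_neg_quadratic hre (-z i * b * r)
    have e1 : ∀ n : ℤ, cexp (-π * z i * ((b * n + r : ℤ) : ℂ) ^ 2) = cexp (-π * z i * r ^ 2) *
        cexp (-π * (z i * ((b : ℝ) ^ 2 : ℝ)) * n ^ 2 + 2 * π * (-z i * b * r) * n) := by
      intro n
      rw [← Complex.exp_add]; congr 1; push_cast; ring
    have e2 : ∀ n : ℤ, cexp (-π * n ^ 2 / (z i * b ^ 2) + 2 * π * I * n * r / b) =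
        cexp (-π * z i * r ^ 2) *
        cexp (-π / (z i * ((b : ℝ) ^ 2 : ℝ)) * (n + I * (-z i * b * r)) ^ 2) := by
      intro n
      rw [← Complex.exp_add]; congr 1; push_cast
      have := hz0 i
      field_simp
      linear_combination ((z i * b * r) ^ 2) * I_sq
    simp_rw [e1, e2, tsum_mul_left, hP]
    have hs : (z i * ((b : ℝ) ^ 2 : ℝ)) ^ (1 / 2 : ℂ) = b * z i ^ (1 / 2 : ℂ) := by
      have hne : (((b : ℝ) ^ 2 : ℝ) : ℂ) ≠ 0 := by exact_mod_cast (pow_pos hbR 2).ne'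
      rw [mul_comm (z i), Complex.cpow_def_of_ne_zero (mul_ne_zero hne (hz0 i)),
        Complex.cpow_def_of_ne_zero (hz0 i), Complex.log_ofReal_mul (by positivity) (hz0 i),
        add_mul, Complex.exp_add, Real.log_pow]
      congr 1
      rw [← ofReal_natCast b, ← Real.exp_log hbR, ofReal_exp, Real.exp_log hbR]
      congr 1
      push_cast; ring
    have hne : z i ^ (1 / 2 : ℂ) ≠ 0 := by
      rw [Complex.cpow_def_of_ne_zero (hz0 i)]; exact Complex.exp_ne_zero _
    rw [hs]
    field_simp
  simp_rw [key]
  have hone : 𝓝 (1 / b : ℂ) = 𝓝 (1 / b * ∑' n : ℤ, (if n = 0 then (1 : ℂ) else 0)) := by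
    rw [tsum_ite_eq]; simp
  refine hone ▸ Tendsto.const_mul _ ?_
  have hnorm : ∀ i (n : ℤ), ‖cexp (-π * n ^ 2 / (z i * b ^ 2) + 2 * π * I * n * r / b)‖ =
      Real.exp (-π * ((z i)⁻¹.re / b ^ 2) * n ^ 2) := by
    intro i n
    rw [Complex.norm_exp]
    congr 1
    have : -π * n ^ 2 / (z i * b ^ 2) + 2 * π * I * n * r / b =
      ((-π * n ^ 2 / b ^ 2 : ℝ) : ℂ) * (z i)⁻¹ + ((2 * π * n * r / b : ℝ) : ℂ) * I := by
      have := hz0 i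
      push_cast; field_simp
    rw [this, add_re, re_ofReal_mul, re_ofReal_mul]
    simp; ring
  have hbound := summable_exp_neg_mul_int_sq one_pos
  refine tendsto_tsum_of_dominated_convergence hbound (fun n => ?_) ?_
  · split_ifs with h
    · subst h; simpa using tendsto_const_nhds
    · rw [tendsto_zero_iff_norm_tendsto_zero]
      simp_rw [hnorm]
      refine Real.tendsto_exp_atBot.comp ?_
      have h2 : (0 : ℝ) < π * n ^ 2 / b ^ 2 := by
        have : (0 : ℝ) < (n : ℝ) ^ 2 := by positivity
        positivity
      have := (tendsto_neg_atTop_atBot.comp (hlim.const_mul_atTop h2))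
      refine this.congr fun i => ?_
      simp only [Function.comp]; ring
  · filter_upwards [hlim.eventually_ge_atTop ((b : ℝ) ^ 2)] with i hi n
    rw [hnorm]
    apply Real.exp_le_exp.mpr
    have : 1 ≤ (z i)⁻¹.re / b ^ 2 := by rwa [le_div_iff₀ (by positivity), one_mul]
    have h3 : 0 ≤ π * (n : ℝ) ^ 2 := by positivity
    nlinarith

lemma tendsto_theta_periodic {ι : Type*} {l : Filter ι} [l.IsCountablyGenerated] {z : ι → ℂ}
    (hz : ∀ i, 0 < (z i).re) (hlim : Tendsto (fun i => ((z i)⁻¹).re) l atTop)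
    {b : ℕ} (hb : 0 < b) {φ : ℤ → ℂ} (hφ : ∀ n r : ℤ, φ (b * n + r) = φ r) (hφ1 : ∀ n, ‖φ n‖ ≤ 1) :
    Tendsto (fun i => z i ^ (1 / 2 : ℂ) * ∑' n : ℤ, φ n * cexp (-π * z i * (n : ℂ) ^ 2)) l
      (𝓝 ((∑ r ∈ Finset.range b, φ r) / b)) := by
  have : NeZero b := ⟨hb.ne'⟩
  have hsum : ∀ i, Summable fun n : ℤ => φ n * cexp (-π * z i * (n : ℂ) ^ 2) := by
    intro i
    refine Summable.of_norm_bounded (summable_exp_neg_mul_int_sq (hz i)) fun n => ?_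
    rw [norm_mul, Complex.norm_exp]
    have e : (-π * z i * (n : ℂ) ^ 2) = z i * ((-π * n ^ 2 : ℝ) : ℂ) := by push_cast; ring
    rw [e, re_mul_ofReal]
    refine (mul_le_of_le_one_left (Real.exp_pos _).le (hφ1 n)).trans_eq ?_
    congr 1; ring
  have key : ∀ i, z i ^ (1 / 2 : ℂ) * ∑' n : ℤ, φ n * cexp (-π * z i * (n : ℂ) ^ 2) =
      ∑ r ∈ Finset.range b, φ r * (z i ^ (1 / 2 : ℂ) *
        ∑' n : ℤ, cexp (-π * z i * ((b * n + (r : ℤ) : ℤ) : ℂ) ^ 2)) := by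
    intro i
    have h1 := hsum i
    rw [← (Int.divModEquiv b).symm.summable_iff] at h1
    have h2 := Summable.tsum_prod ((Equiv.prodComm _ _).summable_iff.mpr h1)
    have h3 := ((Equiv.prodComm (Fin b) ℤ).trans (Int.divModEquiv b).symm).tsum_eq
      (fun n : ℤ => φ n * cexp (-π * z i * (n : ℂ) ^ 2))
    rw [← h3]
    refine (congrArg _ h2).trans ?_
    rw [tsum_fintype, Finset.mul_sum, Finset.sum_range]
    refine Finset.sum_congr rfl fun r _ => ?_
    rw [← tsum_mul_left, ← tsum_mul_left, ← tsum_mul_left]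
    refine tsum_congr fun n => ?_
    simp only [Function.comp, Equiv.prodComm_apply, Prod.swap_prod_mk, Int.divModEquiv_symm_apply]
    have : n * (b : ℤ) + ((r : ℕ) : ℤ) = b * n + (r : ℕ) := by ring
    rw [this, hφ]
    ring
  simp_rw [key]
  rw [Finset.sum_div]
  refine tendsto_finsetSum _ fun r _ => ?_
  have := (tendsto_theta_progression hz hlim hb r).const_mul (φ r)
  rwa [mul_one_div] at this


/-- Evaluation of the quadratic Gauss sum of an arbitrary modulus. -/
theorem sum_exp_sq_div {N : ℕ} (hN : 0 < N) :
    ∑ x ∈ Finset.range N, cexp (2 * π * I * x ^ 2 / N) =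
      √N * ((1 + I) / 2) * (1 + (-I) ^ N) := by
  have hNR : (0 : ℝ) < N := by exact_mod_cast hN
  have hNC : (N : ℂ) ≠ 0 := by exact_mod_cast hN.ne'
  let t : ℕ → ℝ := fun j => j + 1
  have ht : ∀ j, 0 < t j := fun j => by positivity
  have htC : ∀ j, (t j : ℂ) ≠ 0 := fun j => by exact_mod_cast (ht j).ne'
  have htlim : Tendsto t atTop atTop :=
    tendsto_atTop_add_const_right _ _ tendsto_natCast_atTop_atTop
  let z : ℕ → ℂ := fun j => ((t j)⁻¹ : ℝ)
  let v : ℕ → ℂ := fun j => 4 / N ^ 2 + 2 * I / N * (t j)⁻¹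
  let δ : ℕ → ℂ := fun j => ((4 * t j / N ^ 2 : ℝ) + (2 / N : ℝ) * I)⁻¹
  let a : ℕ → ℂ := fun j => z j - 2 * I / N
  have hz : ∀ j, 0 < (z j).re := fun j => by
    simp only [z, ofReal_re]; exact inv_pos.mpr (ht j)
  have hδinv : ∀ j, ((δ j)⁻¹).re = 4 / N ^ 2 * t j := fun j => by
    simp only [δ, inv_inv, add_re, ofReal_re, re_ofReal_mul, I_re]; ring
  have hw0 : ∀ j, ((4 * t j / N ^ 2 : ℝ) + (2 / N : ℝ) * I : ℂ) ≠ 0 := fun j h => by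
    have := hδinv j
    simp only [δ, h, inv_zero, zero_re] at this
    have := ht j
    have : 0 < 4 / (N : ℝ) ^ 2 * t j := by positivity
    linarith
  have hδ : ∀ j, 0 < (δ j).re := fun j => by
    rw [← inv_inv (δ j), inv_re]
    refine div_pos ?_ (normSq_pos.mpr (by simp only [δ, inv_inv]; exact hw0 j))
    rw [hδinv]; have := ht j; positivity
  have ha : ∀ j, 0 < (a j).re := fun j => by
    have : (a j).re = (z j).re := by
      have e : (2 * I / N : ℂ) = ((2 / N : ℝ) : ℂ) * I := by push_cast; ring
      simp only [a, sub_re, e, re_ofReal_mul, I_re]; ring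
    rw [this]; exact hz j
  have ha0 : ∀ j, a j ≠ 0 := fun j h => by have := ha j; simp [h] at this
  have hva : ∀ j, (a j)⁻¹ = N * I / 2 + δ j := fun j => by
    have h1 := hw0 j
    have h2 := ha0 j
    have h3 := htC j
    have e : (4 * t j / N ^ 2 : ℝ) + (2 / N : ℝ) * I = (2 * I * t j / N) * a j := by
      simp only [a, z]; push_cast; field_simp; linear_combination (4 * t j : ℂ) * I_sq
    simp only [δ]
    rw [e] at h1 ⊢
    rw [mul_inv]
    have hI := I_ne_zero
    field_simp
    simp only [a, z]; push_cast; field_simp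
    linear_combination (2 * I * t j - N : ℂ) * I_sq
  have hvδ : ∀ j, δ j = z j * (v j)⁻¹ := fun j => by
    have h3 := htC j
    simp only [δ, z, v, ofReal_inv]
    rw [← mul_inv]; congr 1; push_cast; field_simp
  have hzinv : Tendsto (fun j => ((z j)⁻¹).re) atTop atTop := by
    refine htlim.congr fun j => ?_
    simp only [z, ofReal_inv, inv_inv, ofReal_re]
  have hδlim : Tendsto (fun j => ((δ j)⁻¹).re) atTop atTop := by
    simp_rw [hδinv]
    exact htlim.const_mul_atTop (by positivity)
  have hzlim : Tendsto z atTop (𝓝 0) := by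
    have := (continuous_ofReal.tendsto 0).comp (tendsto_inv_atTop_zero.comp htlim)
    exact (by simpa using this : Tendsto (ofReal ∘ (fun r => r⁻¹) ∘ t) atTop (𝓝 0))
  have L1 := tendsto_theta_periodic hz hzinv hN (φ := fun n => cexp (2 * π * I * n ^ 2 / N))
    (fun n r => by
      rw [Complex.exp_eq_exp_iff_exists_int]
      refine ⟨N * n ^ 2 + 2 * n * r, ?_⟩
      push_cast; field_simp; ring)
    (fun n => by
      have e : 2 * π * I * n ^ 2 / N = ((2 * π * n ^ 2 / N : ℝ) : ℂ) * I := by push_cast; ring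
      rw [e, norm_exp_ofReal_mul_I])
  have L2 := tendsto_theta_periodic hδ hδlim two_pos
    (φ := fun n => cexp (-(π * N * n ^ 2 / 2) * I))
    (fun n r => by
      rw [Complex.exp_eq_exp_iff_exists_int]
      refine ⟨-N * n ^ 2 - N * n * r, ?_⟩
      push_cast; ring)
    (fun n => by
      have e : -(π * N * n ^ 2 / 2 : ℂ) = ((-(π * N * n ^ 2 / 2) : ℝ) : ℂ) := by push_cast; ring
      rw [e, norm_exp_ofReal_mul_I])
  have hM : (∑ r ∈ Finset.range 2, cexp (-(π * N * ((r : ℤ) : ℂ) ^ 2 / 2) * I)) / (2 : ℕ) =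
      (1 + (-I) ^ N) / 2 := by
    have : cexp (-(π / 2 * I)) = -I := by
      rw [Complex.exp_neg, exp_pi_div_two_mul_I, inv_I]
    rw [Finset.sum_range_succ, Finset.sum_range_one, ← this, ← Complex.exp_nat_mul]
    simp
    ring_nf
  rw [hM] at L2
  have hv0 : ∀ j, (v j)⁻¹ ≠ 0 := fun j h => by
    have := hδ j
    rw [hvδ j, h, mul_zero, zero_re] at this
    exact this.false
  have hδz : ∀ j, δ j ^ (1 / 2 : ℂ) = z j ^ (1 / 2 : ℂ) * (v j)⁻¹ ^ (1 / 2 : ℂ) := fun j => by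
    have hz0 : z j ≠ 0 := fun h => by have := hz j; simp [h] at this
    rw [hvδ j, Complex.cpow_def_of_ne_zero (mul_ne_zero hz0 (hv0 j)),
      Complex.cpow_def_of_ne_zero hz0, Complex.cpow_def_of_ne_zero (hv0 j),
      Complex.log_ofReal_mul (inv_pos.mpr (ht j)) (hv0 j), add_mul, Complex.exp_add,
      Complex.ofReal_log (inv_pos.mpr (ht j)).le]
  have key : ∀ j, z j ^ (1 / 2 : ℂ) * ∑' n : ℤ, cexp (2 * π * I * n ^ 2 / N) *
      cexp (-π * z j * (n : ℂ) ^ 2) = (a j ^ (1 / 2 : ℂ))⁻¹ * ((v j)⁻¹ ^ (1 / 2 : ℂ))⁻¹ *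
        (δ j ^ (1 / 2 : ℂ) * ∑' n : ℤ, cexp (-(π * N * n ^ 2 / 2) * I) *
          cexp (-π * δ j * (n : ℂ) ^ 2)) := by
    intro j
    have hP := Complex.tsum_exp_neg_mul_int_sq (ha j)
    have e1 : ∀ n : ℤ, cexp (2 * π * I * n ^ 2 / N) * cexp (-π * z j * (n : ℂ) ^ 2) =
        cexp (-π * a j * (n : ℂ) ^ 2) := fun n => by
      rw [← Complex.exp_add]; congr 1; simp only [a]; ring
    have e2 : ∀ n : ℤ, cexp (-(π * N * n ^ 2 / 2) * I) * cexp (-π * δ j * (n : ℂ) ^ 2) =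
        cexp (-π / a j * (n : ℂ) ^ 2) := fun n => by
      rw [← Complex.exp_add]; congr 1; rw [div_eq_mul_inv _ (a j), hva]; ring
    have hvne : (v j)⁻¹ ^ (1 / 2 : ℂ) ≠ 0 := by
      rw [Complex.cpow_def_of_ne_zero (hv0 j)]; exact Complex.exp_ne_zero _
    simp_rw [e1, e2, hP, hδz]
    generalize (v j)⁻¹ ^ (1 / 2 : ℂ) = w at hvne
    rw [one_div (a j ^ (1 / 2 : ℂ))]
    calc _ = w⁻¹ * w * (z j ^ (1 / 2 : ℂ) * ((a j ^ (1 / 2 : ℂ))⁻¹ *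
        ∑' n : ℤ, cexp (-π / a j * (n : ℂ) ^ 2))) := by rw [inv_mul_cancel₀ hvne, one_mul]
      _ = _ := by ring
  simp_rw [key] at L1
  have ha_lim : Tendsto (fun j => a j ^ (1 / 2 : ℂ)) atTop (𝓝 ((1 - I) / √N)) := by
    have hre : 0 < ((1 - I) / √N : ℂ).re := by
      rw [div_ofReal_re]; simp [hN]
    have hsq : ((1 - I) / √N : ℂ) ^ 2 = -2 * I / N := by
      rw [div_pow, ← ofReal_pow, Real.sq_sqrt hNR.le]
      push_cast; congr 1; linear_combination I_sq
    have h1 := sq_cpow_two_inv hre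
    rw [hsq] at h1
    rw [← h1, one_div]
    refine Tendsto.cpow ?_ tendsto_const_nhds ?_
    · have := hzlim.sub_const (2 * I / N : ℂ)
      rw [zero_sub] at this
      convert this using 2; ring
    · right
      have e : (-2 * I / N : ℂ) = ((-2 / N : ℝ) : ℂ) * I := by push_cast; ring
      rw [e, im_ofReal_mul, I_im, mul_one]
      exact (div_neg_of_neg_of_pos (by norm_num) hNR).ne
  have hv_lim : Tendsto (fun j => (v j)⁻¹ ^ (1 / 2 : ℂ)) atTop (𝓝 (N / 2)) := by
    have hre : 0 < (N / 2 : ℂ).re := by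
      have : (N / 2 : ℂ) = ((N / 2 : ℝ) : ℂ) := by push_cast; rfl
      rw [this, ofReal_re]; positivity
    have h1 := sq_cpow_two_inv hre
    rw [← h1, one_div]
    have e : ((N / 2 : ℂ) ^ 2) = ((N ^ 2 / 4 : ℝ) : ℂ) := by push_cast; ring
    refine Tendsto.cpow ?_ tendsto_const_nhds ?_
    · have e2 : ((N / 2 : ℂ) ^ 2) = (4 / N ^ 2 + 2 * I / N * 0 : ℂ)⁻¹ := by
        rw [mul_zero, add_zero, inv_div]; ring
      rw [e2]
      refine Tendsto.inv₀ (tendsto_const_nhds.add (hzlim.const_mul _)) ?_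
      rw [mul_zero, add_zero]
      exact div_ne_zero (by norm_num) (pow_ne_zero 2 hNC)
    · left
      rw [e, ofReal_re]; positivity
  have hNs : (√N : ℂ) ≠ 0 := by exact_mod_cast (Real.sqrt_pos.mpr hNR).ne'
  have hI1 : (1 - I : ℂ) ≠ 0 := fun h => by simpa using congrArg re h
  have hlim := ((ha_lim.inv₀ (div_ne_zero hI1 hNs)).mul
    (hv_lim.inv₀ (div_ne_zero hNC two_ne_zero))).mul L2
  have huniq := tendsto_nhds_unique L1 hlim
  rw [div_eq_iff hNC] at huniq
  simp only [Int.cast_natCast] at huniq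
  rw [huniq]
  have hinv : ((1 - I) / √N : ℂ)⁻¹ = √N * ((1 + I) / 2) := by
    rw [inv_div, div_eq_iff hI1]
    linear_combination (√N / 2 : ℂ) * I_sq
  rw [hinv]
  field_simp

theorem ee_add (x y : ℂ) : ee (x + y) = ee x * ee y := by
  simp only [ee, mul_add, Complex.exp_add]

theorem ee_int (k : ℤ) : ee k = 1 := by
  rw [ee, mul_comm]; exact Complex.exp_int_mul_two_pi_mul_I k

theorem stdAddChar_intCast_eq_ee {c : ℕ} [NeZero c] (j : ℤ) :
    ZMod.stdAddChar (j : ZMod c) = ee (j / c) := by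
  rw [ZMod.stdAddChar_coe, ee]; congr 1; ring

theorem sum_zmod_eq_sum_range {M : Type*} [AddCommMonoid M] {c : ℕ} [NeZero c] (g : ZMod c → M) :
    ∑ x : ZMod c, g x = ∑ x ∈ Finset.range c, g (x : ZMod c) := by
  symm
  refine Finset.sum_bij (fun x _ => (x : ZMod c)) (fun _ _ => Finset.mem_univ _) ?_ ?_
    (fun _ _ => rfl)
  · intro a ha b hb h
    rw [ZMod.natCast_eq_natCast_iff'] at h
    rwa [Nat.mod_eq_of_lt (Finset.mem_range.mp ha), Nat.mod_eq_of_lt (Finset.mem_range.mp hb)] at h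
  · intro b _
    exact ⟨b.val, Finset.mem_range.mpr (ZMod.val_lt b), ZMod.natCast_zmod_val b⟩

/-- The quadratic Gauss sum `∑ x mod c, e(a x² / c)`. -/
def gaussQuad (c : ℕ) [NeZero c] (a : ZMod c) : ℂ := ∑ x : ZMod c, ZMod.stdAddChar (a * x ^ 2)

theorem gaussQuad_one (c : ℕ) [NeZero c] :
    gaussQuad c 1 = √c * ((1 + I) / 2) * (1 + (-I) ^ c) := by
  rw [← sum_exp_sq_div (Nat.pos_of_ne_zero (NeZero.ne c)), gaussQuad, sum_zmod_eq_sum_range]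
  refine Finset.sum_congr rfl fun x _ => ?_
  have : (1 * (x : ZMod c) ^ 2) = (((x : ℤ) ^ 2 : ℤ) : ZMod c) := by push_cast; ring
  rw [this, ZMod.stdAddChar_coe]
  push_cast; rfl

theorem gaussQuad_one_odd {c : ℕ} [NeZero c] (hc : Odd c) :
    gaussQuad c 1 = epsFactor c * √c := by
  rw [gaussQuad_one, epsFactor]
  have h4 := Nat.div_add_mod c 4
  have hI4 : (-I) ^ 4 = 1 := by rw [neg_pow, I_pow_four]; norm_num
  have hI : (-I) ^ c = (-I) ^ (c % 4) := by
    conv_lhs => rw [← h4, pow_add, pow_mul, hI4, one_pow, one_mul]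
  rw [hI]
  have : c % 4 = 1 ∨ c % 4 = 3 := by rcases hc with ⟨k, rfl⟩; omega
  rcases this with h | h <;> rw [h]
  · simp only [if_true, pow_one]
    linear_combination (-√c / 2 : ℂ) * I_sq
  · norm_num
    rw [show (-I) ^ 3 = I by rw [neg_pow, I_pow_three]; ring]
    linear_combination (√c / 2 : ℂ) * I_sq

theorem gaussQuad_one_four {c : ℕ} [NeZero c] (hc : 4 ∣ c) :
    gaussQuad c 1 = (1 + I) * √c := by
  obtain ⟨k, rfl⟩ := hc
  rw [gaussQuad_one]
  have hI : (-I) ^ (4 * k) = 1 := by 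
    rw [pow_mul, show (-I) ^ 4 = 1 by rw [neg_pow, I_pow_four]; norm_num, one_pow]
  rw [hI]; ring

theorem gaussQuad_mul_sq {c : ℕ} [NeZero c] (a : ZMod c) (u : (ZMod c)ˣ) :
    gaussQuad c (a * u ^ 2) = gaussQuad c a := by
  rw [gaussQuad, gaussQuad]
  refine Fintype.sum_equiv (Units.mulLeft u) _ _ fun x => ?_
  rw [Units.mulLeft_apply]; congr 1; ring

theorem gaussQuad_mul {c d : ℕ} [NeZero c] [NeZero d] [NeZero (c * d)] (h : c.Coprime d) (a : ℤ) :
    gaussQuad (c * d) a = gaussQuad c (a * d) * gaussQuad d (a * c) := by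
  have hb := Nat.gcd_eq_gcd_ab c d
  rw [h] at hb
  set U := Nat.gcdB c d
  set V := Nat.gcdA c d
  push_cast at hb
  have hU : IsUnit (U : ZMod c) := by
    refine IsUnit.of_mul_eq_one (d : ZMod c) ?_
    have := congrArg (Int.cast : ℤ → ZMod c) hb
    push_cast at this
    simp at this
    rw [this]; ring
  have hV : IsUnit (V : ZMod d) := by
    refine IsUnit.of_mul_eq_one (c : ZMod d) ?_
    have := congrArg (Int.cast : ℤ → ZMod d) hb
    push_cast at this
    simp at this
    rw [this]; ring
  simp only [gaussQuad]
  rw [Finset.sum_mul_sum, ← Finset.sum_product', Finset.univ_product_univ]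
  refine Fintype.sum_equiv ((ZMod.chineseRemainder h).toEquiv.trans
    ((Units.mulLeft hU.unit).prodCongr (Units.mulLeft hV.unit))) _ _ fun y => ?_
  obtain ⟨y, rfl⟩ := ZMod.intCast_surjective y
  have e1 : ((ZMod.chineseRemainder h).toEquiv.trans
    ((Units.mulLeft hU.unit).prodCongr (Units.mulLeft hV.unit))) (y : ZMod (c * d)) =
      ((U * y : ZMod c), (V * y : ZMod d)) := by
    simp
    rfl
  rw [e1]
  have f1 : (a * (y : ZMod (c * d)) ^ 2) = ((a * y ^ 2 : ℤ) : ZMod (c * d)) := by push_cast; rfl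
  have f2 : (a * d * (U * (y : ZMod c)) ^ 2) = ((a * d * (U * y) ^ 2 : ℤ) : ZMod c) := by
    push_cast; rfl
  have f3 : (a * c * (V * (y : ZMod d)) ^ 2) = ((a * c * (V * y) ^ 2 : ℤ) : ZMod d) := by
    push_cast; rfl
  simp only []
  rw [f1, f2, f3, stdAddChar_intCast_eq_ee, stdAddChar_intCast_eq_ee, stdAddChar_intCast_eq_ee,
    ← ee_add, ← mul_one (ee (_ + _)), ← ee_int (2 * U * V * a * y ^ 2), ← ee_add]
  congr 1
  have hc0 : (c : ℂ) ≠ 0 := Nat.cast_ne_zero.mpr (NeZero.ne c)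
  have hd0 : (d : ℂ) ≠ 0 := Nat.cast_ne_zero.mpr (NeZero.ne d)
  have hb' : (1 : ℂ) = c * V + d * U := by exact_mod_cast hb
  push_cast
  field_simp
  linear_combination ((a : ℂ) * y ^ 2 * (1 + (c * V + d * U))) * hb'

theorem gaussQuad_prime {p : ℕ} [Fact p.Prime] (hp : p ≠ 2) {a : ZMod p} (ha : a ≠ 0) :
    gaussQuad p a = quadraticChar (ZMod p) a * gaussQuad p 1 := by
  classical
  have key : ∀ b : ZMod p, b ≠ 0 → gaussQuad p b =
      ∑ y : ZMod p, (quadraticChar (ZMod p) y : ℂ) * ZMod.stdAddChar (b * y) := by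
    intro b hb
    have h1 : gaussQuad p b = ∑ y : ZMod p, ((quadraticChar (ZMod p) y : ℂ) + 1) *
        ZMod.stdAddChar (b * y) := by
      rw [gaussQuad]
      rw [← Finset.sum_fiberwise Finset.univ (fun x : ZMod p => x ^ 2)]
      refine Finset.sum_congr rfl fun y _ => ?_
      rw [Finset.sum_congr rfl (g := fun _ => ZMod.stdAddChar (b * y))]
      · rw [Finset.sum_const, nsmul_eq_mul]
        congr 1
        have := quadraticChar_card_sqrts (F := ZMod p) (by rwa [ZMod.ringChar_zmod_n]) y
        have h2 := congrArg (Int.cast : ℤ → ℂ) this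
        push_cast at h2
        rw [← h2]
        congr 2
        ext x; simp
      · intro x hx
        rw [(Finset.mem_filter.mp hx).2]
    rw [h1]
    simp only [add_mul, one_mul, Finset.sum_add_distrib]
    have := AddChar.sum_mulShift (ψ := ZMod.stdAddChar) b (ZMod.isPrimitive_stdAddChar p)
    simp only [mul_comm _ b] at this
    rw [this, if_neg hb]; simp
  rw [key a ha, key 1 one_ne_zero, Finset.mul_sum]
  refine Fintype.sum_equiv (Units.mulLeft (Units.mk0 a ha)) _ _ fun y => ?_
  simp only [Units.mulLeft_apply, Units.val_mk0, map_mul]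
  have := quadraticChar_sq_one ha
  have h2 := congrArg (Int.cast : ℤ → ℂ) this
  push_cast at h2
  push_cast
  rw [one_mul]
  linear_combination (-(quadraticChar (ZMod p) y : ℂ) * ZMod.stdAddChar (a * y)) * h2

theorem gaussQuad_prime_nat {p : ℕ} [Fact p.Prime] (hp : p ≠ 2) {a : ℕ} (ha : a.Coprime p) :
    gaussQuad p a = jacobiSym a p * (epsFactor p * √p) := by
  have hp' : p.Prime := Fact.out
  have ha' : (a : ZMod p) ≠ 0 := ((ZMod.isUnit_iff_coprime a p).mpr ha).ne_zero
  rw [gaussQuad_prime hp ha', gaussQuad_one_odd (hp'.odd_of_ne_two hp),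
    ← jacobiSym.legendreSym.to_jacobiSym, legendreSym]
  simp

theorem epsFactor_ne_zero (d : ℕ) : epsFactor d ≠ 0 := by
  rw [epsFactor]; split_ifs <;> simp

theorem jacobiSym_sq_cast {a : ℤ} {b : ℕ} (h : a.gcd b = 1) : ((jacobiSym a b : ℤ) : ℂ) ^ 2 = 1 := by
  exact_mod_cast jacobiSym.sq_one h

/-- Evaluation at an odd prime numerator, through reciprocity for Gauss sums. -/
theorem gaussQuad_mul_of_prime {p c : ℕ} [Fact p.Prime] [NeZero c] (hp : p ≠ 2)
    (h : c.Coprime p) :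
    gaussQuad c p * (epsFactor p * √p) = jacobiSym c p * gaussQuad (c * p) 1 := by
  have h1 := gaussQuad_mul h 1
  rw [Int.cast_one, Int.cast_one, Int.cast_one, one_mul, one_mul, gaussQuad_prime_nat hp h] at h1
  have h2 : ((jacobiSym c p : ℤ) : ℂ) ^ 2 = 1 := jacobiSym_sq_cast (by simpa using h)
  rw [h1]
  linear_combination (-gaussQuad c p * (epsFactor p * √p)) * h2

theorem gaussQuad_odd {a c : ℕ} [NeZero c] (hc : Odd c) (h : a.Coprime c) :
    gaussQuad c a = jacobiSym a c * (epsFactor c * √c) := by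
  have h4c : Nat.Coprime 4 c := by
    have : Nat.Coprime 2 c := (Nat.coprime_two_left).mpr hc
    simpa using this.pow_left 2
  obtain ⟨b, hb1, hb2⟩ := Nat.chineseRemainder h4c 1 a
  have hbu : IsUnit (b : ZMod (4 * c)) := by
    rw [ZMod.isUnit_iff_coprime]
    refine Nat.Coprime.mul_right ?_ ?_
    · rw [Nat.Coprime, hb1.gcd_eq, Nat.gcd_one_left]
    · rw [Nat.Coprime, hb2.gcd_eq]; exact h
  have : NeZero (4 * c) := ⟨by have := NeZero.ne c; omega⟩
  obtain ⟨p, hpgt, hp, hpb⟩ := Nat.forall_exists_prime_gt_and_eq_mod hbu (4 * c)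
  have : Fact p.Prime := ⟨hp⟩
  have hc0 := Nat.pos_of_ne_zero (NeZero.ne c)
  have hp2 : p ≠ 2 := by omega
  rw [ZMod.natCast_eq_natCast_iff] at hpb
  have hp4 : p % 4 = 1 := (hpb.of_mul_right c).trans hb1
  have hpc : p ≡ a [MOD c] := (hpb.of_mul_left 4).trans hb2
  have hcop : c.Coprime p := by
    rw [Nat.coprime_comm, Nat.Coprime, hpc.gcd_eq]; exact h
  have hpa : (p : ZMod c) = a := (ZMod.natCast_eq_natCast_iff _ _ _).mpr hpc
  have : NeZero (c * p) := ⟨(Nat.mul_pos hc0 hp.pos).ne'⟩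
  have key := gaussQuad_mul_of_prime hp2 hcop
  have hodd : Odd (c * p) := hc.mul (hp.odd_of_ne_two hp2)
  rw [gaussQuad_one_odd hodd, hpa] at key
  have e1 : epsFactor (c * p) = epsFactor c := by
    simp only [epsFactor, Nat.mul_mod, hp4, mul_one, Nat.mod_mod]
  have e2 : epsFactor p = 1 := by simp [epsFactor, hp4]
  have e3 : jacobiSym c p = jacobiSym a c := by
    rw [← jacobiSym.quadratic_reciprocity_one_mod_four hp4 hc]
    rw [jacobiSym.mod_left, jacobiSym.mod_left a c]
    congr 1
    exact_mod_cast hpc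
  have hps : (√p : ℂ) ≠ 0 := by
    exact_mod_cast (Real.sqrt_pos.mpr (by exact_mod_cast hp.pos : (0 : ℝ) < p)).ne'
  rw [e1, e2, e3] at key
  have e4 : (√((c * p : ℕ) : ℝ) : ℂ) = √c * √p := by
    rw [Nat.cast_mul, Real.sqrt_mul (Nat.cast_nonneg _)]; push_cast; rfl
  rw [e4] at key
  apply mul_right_cancel₀ hps
  linear_combination key

theorem jacobiSym_four_mul {k b : ℕ} (hb : Odd b) :
    jacobiSym ((4 * k : ℕ) : ℤ) b = jacobiSym k b := by
  have h : jacobiSym ((2 : ℕ) : ℤ) b ^ 2 = 1 := jacobiSym.sq_one (by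
    rw [Int.gcd_natCast_natCast]; exact (Nat.coprime_two_left).mpr hb)
  rw [show ((4 * k : ℕ) : ℤ) = ((2 : ℕ) : ℤ) ^ 2 * k by push_cast; ring, jacobiSym.mul_left,
    jacobiSym.pow_left, h, one_mul]

theorem gaussQuad_four_dvd {a c : ℕ} [NeZero c] (hc : 4 ∣ c) (h : a.Coprime c) :
    gaussQuad c a = (1 + I) * √c * (jacobiSym c a * (epsFactor a) ^ 3) := by
  have hau : IsUnit (a : ZMod c) := (ZMod.isUnit_iff_coprime a c).mpr h
  obtain ⟨p, hpgt, hp, hpb⟩ := Nat.forall_exists_prime_gt_and_eq_mod hau c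
  have : Fact p.Prime := ⟨hp⟩
  have hc0 := Nat.pos_of_ne_zero (NeZero.ne c)
  have hc4 := Nat.le_of_dvd hc0 hc
  have hp2 : p ≠ 2 := by omega
  have hpc := (ZMod.natCast_eq_natCast_iff _ _ _).mp hpb
  have hcop : c.Coprime p := by
    rw [Nat.coprime_comm, Nat.Coprime, hpc.gcd_eq]; exact h
  have hpa4 : p % 4 = a % 4 := hpc.of_dvd hc
  have : NeZero (c * p) := ⟨(Nat.mul_pos hc0 hp.pos).ne'⟩
  have key := gaussQuad_mul_of_prime hp2 hcop
  rw [gaussQuad_one_four (hc.mul_right p), hpb] at key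
  have podd := hp.odd_of_ne_two hp2
  have aodd : Odd a := by rw [Nat.odd_iff] at podd ⊢; omega
  have e2 : epsFactor p = epsFactor a := by simp [epsFactor, hpa4]
  have e3 : jacobiSym c p = jacobiSym c a := by
    obtain ⟨k, rfl⟩ := hc
    rw [jacobiSym_four_mul podd, jacobiSym_four_mul aodd, jacobiSym.mod_right _ podd,
      jacobiSym.mod_right _ aodd, Int.natAbs_natCast]
    congr 1
  have hps : (√p : ℂ) ≠ 0 := by
    exact_mod_cast (Real.sqrt_pos.mpr (by exact_mod_cast hp.pos : (0 : ℝ) < p)).ne'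
  have e4 : (√((c * p : ℕ) : ℝ) : ℂ) = √c * √p := by
    rw [Nat.cast_mul, Real.sqrt_mul (Nat.cast_nonneg _)]; push_cast; rfl
  have e5 : epsFactor a ^ 4 = 1 := by
    rw [epsFactor]; split_ifs <;> simp
  rw [e2, e3, e4] at key
  apply mul_right_cancel₀ hps
  apply mul_right_cancel₀ (epsFactor_ne_zero a)
  linear_combination key - ((1 + I) * √c * jacobiSym c a * √p) * e5

/-- The number of solutions of `x² + n ≡ 0` modulo `d` (zero for `d = 0`). -/
def rootCount (n : ℤ) : ArithmeticFunction ℤ where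
  toFun d := ((Finset.range d).filter fun x : ℕ => (d : ℤ) ∣ (x : ℤ) ^ 2 + n).card
  map_zero' := by simp

theorem rootCount_apply (n : ℤ) (d : ℕ) : rootCount n d =
    (((Finset.range d).filter fun x : ℕ => (d : ℤ) ∣ (x : ℤ) ^ 2 + n).card : ℤ) := rfl

/-- The Möbius transform of `rootCount`. -/
def rootMoebius (n : ℤ) : ArithmeticFunction ℤ := ArithmeticFunction.moebius * rootCount n

theorem sum_range_mul_of_periodic {M : Type*} [AddCommMonoid M] {f : ℕ → M} {d : ℕ}
    (hf : Function.Periodic f d) (k : ℕ) :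
    ∑ x ∈ Finset.range (k * d), f x = k • ∑ x ∈ Finset.range d, f x := by
  induction k with
  | zero => simp
  | succ k ih =>
    rw [add_mul, one_mul, Finset.sum_range_add, ih, succ_nsmul]
    congr 1
    refine Finset.sum_congr rfl fun x _ => ?_
    rw [add_comm]
    exact hf.nat_mul k x

theorem card_filter_range_mul {P : ℕ → Prop} [DecidablePred P] {d : ℕ}
    (hf : ∀ x, P (x + d) ↔ P x) (k : ℕ) :
    ((Finset.range (k * d)).filter P).card = k * ((Finset.range d).filter P).card := by
  rw [Finset.card_filter, Finset.card_filter, sum_range_mul_of_periodic, smul_eq_mul]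
  intro x
  simp only [hf]

theorem dvd_sq_add_periodic (n : ℤ) (d x : ℕ) :
    (d : ℤ) ∣ ((x + d : ℕ) : ℤ) ^ 2 + n ↔ (d : ℤ) ∣ (x : ℤ) ^ 2 + n := by
  rw [show ((x + d : ℕ) : ℤ) ^ 2 + n = d * (2 * x + d) + ((x : ℤ) ^ 2 + n) by push_cast; ring]
  exact (Int.dvd_add_right (dvd_mul_right _ _))

theorem sum_ee_mul_div {k : ℕ} (hk : 0 < k) (y : ℤ) :
    ∑ j ∈ Finset.range k, ee (((j * y : ℤ) : ℂ) / k) = if (k : ℤ) ∣ y then (k : ℂ) else 0 := by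
  have : NeZero k := ⟨hk.ne'⟩
  have h := AddChar.sum_mulShift (ψ := ZMod.stdAddChar) (y : ZMod k) (ZMod.isPrimitive_stdAddChar k)
  rw [sum_zmod_eq_sum_range] at h
  simp only [ZMod.intCast_zmod_eq_zero_iff_dvd, ZMod.card] at h
  push_cast at h
  rw [← h]
  refine Finset.sum_congr rfl fun j _ => ?_
  rw [← stdAddChar_intCast_eq_ee]
  push_cast; rfl

/-- Sum over the reduced residues `b` of the sums `∑ x mod c, e(b (x² + n) / c)`. -/
def reducedSum (n : ℤ) (c : ℕ) : ℂ :=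
  ∑ b ∈ Finset.range c, if b.Coprime c then
    ∑ x ∈ Finset.range c, ee (((b * ((x : ℤ) ^ 2 + n) : ℤ) : ℂ) / c) else 0

theorem sum_coprime_eq_sum_divisors {c : ℕ} (hc : 0 < c) (F : ℕ → ℂ) :
    (∑ b ∈ Finset.range c, if b.Coprime c then F b else 0) =
      ∑ e ∈ c.divisors, (ArithmeticFunction.moebius e : ℂ) *
        ∑ j ∈ Finset.range (c / e), F (e * j) := by
  have h1 : ∀ b : ℕ, (if b.Coprime c then F b else 0) =
      ∑ e ∈ c.divisors, if e ∣ b then (ArithmeticFunction.moebius e : ℂ) * F b else 0 := by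
    intro b
    rw [← Finset.sum_filter]
    have h2 : c.divisors.filter (fun e => e ∣ b) = (b.gcd c).divisors := by
      ext e
      simp only [Finset.mem_filter, Nat.mem_divisors, Nat.dvd_gcd_iff]
      have := Nat.gcd_pos_of_pos_right b hc
      constructor
      · rintro ⟨⟨h, _⟩, h'⟩; exact ⟨⟨h', h⟩, this.ne'⟩
      · rintro ⟨⟨h', h⟩, _⟩; exact ⟨⟨h, hc.ne'⟩, h'⟩
    rw [h2, ← Finset.sum_mul]
    have h3 := congrArg (fun f : ArithmeticFunction ℤ => f (b.gcd c))
      ArithmeticFunction.moebius_mul_coe_zeta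
    simp only [ArithmeticFunction.coe_mul_zeta_apply, ArithmeticFunction.one_apply] at h3
    have h4 := congrArg (Int.cast : ℤ → ℂ) h3
    push_cast at h4
    rw [h4]
    by_cases h : b.gcd c = 1 <;> simp [Nat.Coprime, h]
  simp only [h1]
  rw [Finset.sum_comm]
  refine Finset.sum_congr rfl fun e he => ?_
  obtain ⟨k, rfl⟩ := Nat.dvd_of_mem_divisors he
  have he0 : 0 < e := Nat.pos_of_mem_divisors he
  rw [Nat.mul_div_cancel_left _ he0, ← Finset.sum_filter, ← Finset.mul_sum]
  congr 1
  symm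
  refine Finset.sum_bij (fun j _ => e * j) ?_ ?_ ?_ (fun _ _ => rfl)
  · intro j hj
    exact Finset.mem_filter.mpr ⟨Finset.mem_range.mpr
      (Nat.mul_lt_mul_of_pos_left (Finset.mem_range.mp hj) he0), dvd_mul_right _ _⟩
  · intro a _ b _ h
    exact Nat.eq_of_mul_eq_mul_left he0 h
  · intro b hb
    obtain ⟨hb1, j, rfl⟩ := Finset.mem_filter.mp hb
    exact ⟨j, Finset.mem_range.mpr (Nat.lt_of_mul_lt_mul_left (Finset.mem_range.mp hb1)), rfl⟩

theorem reducedSum_eq (n : ℤ) {c : ℕ} (hc : 0 < c) :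
    reducedSum n c = c * rootMoebius n c := by
  rw [reducedSum, sum_coprime_eq_sum_divisors hc
    (fun b => ∑ x ∈ Finset.range c, ee (((b * ((x : ℤ) ^ 2 + n) : ℤ) : ℂ) / c)),
    rootMoebius, ArithmeticFunction.mul_apply,
    Nat.sum_divisorsAntidiagonal (fun a b => ArithmeticFunction.moebius a * rootCount n b)]
  rw [Int.cast_sum, Finset.mul_sum]
  refine Finset.sum_congr rfl fun e he => ?_
  obtain ⟨k, rfl⟩ := Nat.dvd_of_mem_divisors he
  have he0 : 0 < e := Nat.pos_of_mem_divisors he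
  have hk0 : 0 < k := Nat.pos_of_mul_pos_left hc
  rw [Nat.mul_div_cancel_left _ he0, Int.cast_mul, mul_left_comm]
  congr 1
  rw [Finset.sum_comm]
  have h1 : ∀ x : ℕ, ∑ j ∈ Finset.range k,
      ee (((((e * j : ℕ) : ℤ) * ((x : ℤ) ^ 2 + n) : ℤ) : ℂ) / ((e * k : ℕ) : ℂ)) =
      if (k : ℤ) ∣ (x : ℤ) ^ 2 + n then (k : ℂ) else 0 := by
    intro x
    rw [← sum_ee_mul_div hk0]
    refine Finset.sum_congr rfl fun j _ => ?_
    congr 1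
    push_cast
    have : (e : ℂ) ≠ 0 := Nat.cast_ne_zero.mpr he0.ne'
    rw [mul_assoc, mul_div_mul_left _ _ this]
  simp only [h1]
  rw [← Finset.sum_filter, Finset.sum_const,
    card_filter_range_mul (fun x => dvd_sq_add_periodic n k x), rootCount_apply]
  simp only [nsmul_eq_mul]
  push_cast; ring

theorem epsFactor_pow_four (a : ℕ) : epsFactor a ^ 4 = 1 := by
  rw [epsFactor]; split_ifs <;> simp

theorem reducedSum_eq_sum_gaussQuad (n : ℤ) (c : ℕ) [NeZero c] :
    reducedSum n c = ∑ b ∈ Finset.range c,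
      if b.Coprime c then gaussQuad c b * ee (((n * b : ℤ) : ℂ) / c) else 0 := by
  rw [reducedSum]
  refine Finset.sum_congr rfl fun b _ => ?_
  split_ifs
  · rw [gaussQuad, sum_zmod_eq_sum_range, Finset.sum_mul]
    refine Finset.sum_congr rfl fun x _ => ?_
    rw [show (b : ZMod c) * (x : ZMod c) ^ 2 = ((b * x ^ 2 : ℤ) : ZMod c) by push_cast; rfl,
      stdAddChar_intCast_eq_ee, ← ee_add]
    congr 1
    push_cast; ring
  · rfl

theorem gaussQuad_inv {c a d : ℕ} [NeZero c] (h : (a : ZMod c) * d = 1) :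
    gaussQuad c d = gaussQuad c a := by
  have hd : IsUnit (d : ZMod c) := IsUnit.of_mul_eq_one (a : ZMod c) (by rw [mul_comm]; exact h)
  rw [← gaussQuad_mul_sq (a : ZMod c) hd.unit, IsUnit.unit_spec]
  congr 1
  linear_combination (-(d : ZMod c)) * h

theorem cube_eq_self_of_sq {x : ℂ} (h : x ^ 2 = 1) : x ^ 3 = x := by
  rw [pow_succ, h, one_mul]

theorem ee_neg_eighth : ee (-(1 : ℂ) / 8) * (1 + I) = √2 := by
  have h : ee (-(1 : ℂ) / 8) = Complex.exp ((-(π / 4) : ℝ) * I) := by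
    rw [ee]; congr 1; push_cast; ring
  rw [h, Complex.exp_mul_I, ← Complex.ofReal_cos, ← Complex.ofReal_sin, Real.cos_neg, Real.sin_neg,
    Real.cos_pi_div_four, Real.sin_pi_div_four]
  push_cast
  linear_combination (-(√2 : ℂ) / 2) * I_sq

theorem SKe_eq (n : ℤ) {c : ℕ} (hc : Even c) (hc0 : 0 < c) :
    SKe n 0 c 3 = ee (-(1 : ℂ) / 8) * √c * rootMoebius n (2 * c) := by
  have : NeZero (2 * c) := ⟨by omega⟩
  have h4 : 4 ∣ 2 * c := by obtain ⟨k, rfl⟩ := hc; exact ⟨k, by ring⟩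
  have hI1 : (1 + I : ℂ) ≠ 0 := fun h => by simpa using congrArg re h
  have hcs : (√c : ℂ) ≠ 0 := by
    exact_mod_cast (Real.sqrt_pos.mpr (by exact_mod_cast hc0 : (0 : ℝ) < c)).ne'
  have h2s : (√2 : ℂ) ≠ 0 := by
    exact_mod_cast (Real.sqrt_pos.mpr two_pos).ne'
  have hsq : (√((2 * c : ℕ) : ℝ) : ℂ) = √2 * √c := by
    rw [Nat.cast_mul, Real.sqrt_mul (Nat.cast_nonneg _)]; push_cast; rfl
  have hinner : ∀ a ∈ Finset.Ico 1 (2 * c), (∑ d ∈ Finset.Ico 1 (2 * c),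
      if (a * d) % (2 * c) = 1 then
        epsFactor d ^ 3 * ((jacobiSym (2 * (c : ℤ)) d : ℤ) : ℂ) ^ 3 *
          ee (((n * a + 0 * d : ℤ) : ℂ) / (2 * (c : ℕ))) else 0) =
      ((1 + I) * (√2 * √c))⁻¹ * if a.Coprime (2 * c) then
        gaussQuad (2 * c) a * ee (((n * a : ℤ) : ℂ) / (2 * c : ℕ)) else 0 := by
    intro a _
    have hiff : ∀ d : ℕ, (a * d) % (2 * c) = 1 ↔ (a : ZMod (2 * c)) * d = 1 := by
      intro d
      rw [← Nat.cast_mul, ← Nat.cast_one (R := ZMod (2 * c)), ZMod.natCast_eq_natCast_iff',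
        Nat.mod_eq_of_lt
        (by omega : 1 < 2 * c)]
    split_ifs with hco
    · set u : ZMod (2 * c) := (a : ZMod (2 * c))⁻¹ with hu
      have hau : (a : ZMod (2 * c)) * u = 1 := ZMod.coe_mul_inv_eq_one a hco
      have hd0 : (a : ZMod (2 * c)) * (u.val : ℕ) = 1 := by rw [ZMod.natCast_zmod_val, hau]
      rw [Finset.sum_eq_single u.val]
      · rw [if_pos ((hiff _).mpr hd0)]
        have hdc : u.val.Coprime (2 * c) := by
          rw [← ZMod.isUnit_iff_coprime]
          exact IsUnit.of_mul_eq_one (a : ZMod (2 * c)) ((mul_comm _ _).trans hd0)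
        have hg := gaussQuad_four_dvd h4 hdc
        rw [gaussQuad_inv hd0, hsq] at hg
        rw [hg]
        have hJ : ((jacobiSym (2 * (c : ℤ)) u.val : ℤ) : ℂ) ^ 2 = 1 := by
          apply jacobiSym_sq_cast
          have := hdc.symm
          rw [Nat.Coprime, ← Int.gcd_natCast_natCast] at this
          exact_mod_cast this
        rw [cube_eq_self_of_sq hJ]
        push_cast
        rw [zero_mul, add_zero]
        field_simp
      · intro d hd hne
        rw [if_neg]
        intro h
        rw [hiff] at h
        apply hne
        have : (d : ZMod (2 * c)) = u := by
          linear_combination u * h - (d : ZMod (2 * c)) * hau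
        rw [← this, ZMod.val_natCast, Nat.mod_eq_of_lt (Finset.mem_Ico.mp hd).2]
      · intro h
        exfalso
        apply h
        refine Finset.mem_Ico.mpr ⟨?_, ZMod.val_lt u⟩
        by_contra h0
        rw [show u.val = 0 by omega] at hd0
        rw [Nat.cast_zero, mul_zero] at hd0
        have := (hiff 0).mpr (by rw [Nat.cast_zero, mul_zero]; exact hd0)
        simp at this
    · rw [mul_zero]
      refine Finset.sum_eq_zero fun d _ => if_neg fun h => hco ?_
      rw [← ZMod.isUnit_iff_coprime]
      exact IsUnit.of_mul_eq_one (d : ZMod (2 * c)) ((hiff d).mp h)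
  rw [SKe, Finset.sum_comm, Finset.sum_congr rfl hinner, ← Finset.mul_sum]
  have hR := reducedSum_eq_sum_gaussQuad n (2 * c)
  rw [Finset.range_eq_Ico, Finset.sum_eq_sum_Ico_succ_bot (by omega), if_neg, zero_add] at hR
  · rw [zero_add] at hR
    rw [← hR, reducedSum_eq n (by omega)]
    have hcc : ((2 * c : ℕ) : ℂ) = √2 ^ 2 * √c ^ 2 := by
      norm_cast
      rw [Real.sq_sqrt (by norm_num), Real.sq_sqrt (Nat.cast_nonneg _)]
      push_cast; rfl
    rw [hcc]
    have := ee_neg_eighth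
    generalize ee (-(1 : ℂ) / 8) = E at this ⊢
    field_simp
    linear_combination (-(rootMoebius n (2 * c) : ℂ)) * this
  · rw [Nat.coprime_zero_left]; omega

theorem sum_range_two_mul_even {M : Type*} [AddCommMonoid M] (f : ℕ → M) (c : ℕ) :
    (∑ d ∈ Finset.range (2 * c), if d % 2 = 0 then f d else 0) =
      ∑ d ∈ Finset.range c, f (2 * d) := by
  induction c with
  | zero => simp
  | succ k ih =>
    rw [mul_add, mul_one, Finset.sum_range_succ, Finset.sum_range_succ, ih,
      Finset.sum_range_succ, if_pos (by omega), if_neg (by omega), add_zero]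

theorem SKo_eq (n : ℤ) {c : ℕ} (hc : Odd c) :
    SKo n 0 c 3 = ee ((3 : ℂ) / 8) * √c * rootMoebius n c := by
  have hc0 : 0 < c := hc.pos
  have : NeZero c := ⟨by omega⟩
  have hcs : (√c : ℂ) ≠ 0 := by
    exact_mod_cast (Real.sqrt_pos.mpr (by exact_mod_cast hc0 : (0 : ℝ) < c)).ne'
  have hε := epsFactor_ne_zero c
  have h4 : Nat.Coprime 4 c := by
    simpa using ((Nat.coprime_two_left).mpr hc).pow_left 2
  have hinner : ∀ a ∈ Finset.range c, (∑ d ∈ Finset.range c,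
      if (2 * a * (2 * d)) % c = 1 % c then
        ((jacobiSym (2 * ((2 * d : ℕ) : ℤ)) c : ℤ) : ℂ) ^ 3 *
          ee (((n * (2 * a : ℕ) + 0 * (2 * d : ℕ) : ℤ) : ℂ) / (2 * (c : ℕ))) else 0) =
      (epsFactor c * √c)⁻¹ * if a.Coprime c then
        gaussQuad c a * ee (((n * a : ℤ) : ℂ) / c) else 0 := by
    intro a _
    have hiff : ∀ d : ℕ, (2 * a * (2 * d)) % c = 1 % c ↔ ((4 * a : ℕ) : ZMod c) * d = 1 := by
      intro d
      rw [← Nat.cast_mul, ← Nat.cast_one (R := ZMod c), ZMod.natCast_eq_natCast_iff',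
        show 2 * a * (2 * d) = 4 * a * d by ring]
    split_ifs with hco
    · set u : ZMod c := ((4 * a : ℕ) : ZMod c)⁻¹ with hu
      have hau : ((4 * a : ℕ) : ZMod c) * u = 1 := ZMod.coe_mul_inv_eq_one _ (h4.mul_left hco)
      have hd0 : ((4 * a : ℕ) : ZMod c) * (u.val : ℕ) = 1 := by rw [ZMod.natCast_zmod_val, hau]
      rw [Finset.sum_eq_single u.val]
      · rw [if_pos ((hiff _).mpr hd0), gaussQuad_odd hc hco]
        have hJa : ((jacobiSym a c : ℤ) : ℂ) ^ 2 = 1 :=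
          jacobiSym_sq_cast (by simpa using hco)
        have hJ : ((jacobiSym (2 * ((2 * u.val : ℕ) : ℤ)) c : ℤ) : ℂ) = jacobiSym a c := by
          have h1 : jacobiSym a c * jacobiSym (2 * ((2 * u.val : ℕ) : ℤ)) c = 1 := by
            rw [← jacobiSym.mul_left, jacobiSym.mod_left]
            have h2 := (hiff _).mpr hd0
            have h3 : ((a : ℤ) * (2 * ((2 * u.val : ℕ) : ℤ))) % c = 1 % c := by
              have h5 : a * (2 * (2 * u.val)) = 2 * a * (2 * u.val) := by ring
              rw [← h5] at h2
              exact_mod_cast h2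
            rw [h3, ← jacobiSym.mod_left, jacobiSym.one_left]
          have h6 := congrArg (Int.cast : ℤ → ℂ) h1
          push_cast at h6 ⊢
          linear_combination ((jacobiSym a c : ℤ) : ℂ) * h6 -
            ((jacobiSym (2 * (2 * (u.val : ℤ))) c : ℤ) : ℂ) * hJa
        rw [hJ, cube_eq_self_of_sq hJa]
        have e1 : ((n * (2 * a : ℕ) + 0 * (2 * u.val : ℕ) : ℤ) : ℂ) / (2 * (c : ℕ)) =
            ((n * a : ℤ) : ℂ) / c := by
          have : (c : ℂ) ≠ 0 := Nat.cast_ne_zero.mpr hc0.ne'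
          push_cast; field_simp; ring
        rw [e1]
        field_simp
      · intro d hd hne
        rw [if_neg]
        intro h
        rw [hiff] at h
        apply hne
        have : (d : ZMod c) = u := by
          linear_combination u * h - (d : ZMod c) * hau
        rw [← this, ZMod.val_natCast, Nat.mod_eq_of_lt (Finset.mem_range.mp hd)]
      · intro h
        exact absurd (Finset.mem_range.mpr (ZMod.val_lt u)) h
    · rw [mul_zero]
      refine Finset.sum_eq_zero fun d _ => if_neg fun h => hco ?_
      have := IsUnit.of_mul_eq_one (d : ZMod c) ((hiff d).mp h)
      rw [ZMod.isUnit_iff_coprime] at this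
      exact Nat.Coprime.coprime_mul_left this
  have hsplit : ∀ d a : ℕ, (if d % 2 = 0 ∧ a % 2 = 0 ∧ (a * d) % c = 1 % c then
        ((jacobiSym (2 * (d : ℤ)) c : ℤ) : ℂ) ^ 3 *
          ee (((n * a + 0 * d : ℤ) : ℂ) / (2 * (c : ℕ))) else 0) =
      if a % 2 = 0 then if d % 2 = 0 then if (a * d) % c = 1 % c then
        ((jacobiSym (2 * (d : ℤ)) c : ℤ) : ℂ) ^ 3 *
          ee (((n * a + 0 * d : ℤ) : ℂ) / (2 * (c : ℕ))) else 0 else 0 else 0 := by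
    intro d a
    by_cases h1 : d % 2 = 0 <;> by_cases h2 : a % 2 = 0 <;> simp [h1, h2]
  rw [SKo, Finset.sum_comm]
  simp only [hsplit]
  have hpull : ∀ a : ℕ, (∑ d ∈ Finset.range (2 * c), if a % 2 = 0 then if d % 2 = 0 then
        if (a * d) % c = 1 % c then
        ((jacobiSym (2 * (d : ℤ)) c : ℤ) : ℂ) ^ 3 *
          ee (((n * a + 0 * d : ℤ) : ℂ) / (2 * (c : ℕ))) else 0 else 0 else 0) =
      if a % 2 = 0 then ∑ d ∈ Finset.range (2 * c), if d % 2 = 0 then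
        if (a * d) % c = 1 % c then
        ((jacobiSym (2 * (d : ℤ)) c : ℤ) : ℂ) ^ 3 *
          ee (((n * a + 0 * d : ℤ) : ℂ) / (2 * (c : ℕ))) else 0 else 0 else 0 := by
    intro a
    split_ifs <;> simp
  simp only [hpull]
  rw [sum_range_two_mul_even (fun a => ∑ d ∈ Finset.range (2 * c), if d % 2 = 0 then
        if (a * d) % c = 1 % c then
        ((jacobiSym (2 * (d : ℤ)) c : ℤ) : ℂ) ^ 3 *
          ee (((n * a + 0 * d : ℤ) : ℂ) / (2 * (c : ℕ))) else 0 else 0)]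
  have hred : ∀ a : ℕ, (∑ d ∈ Finset.range (2 * c), if d % 2 = 0 then
        if (2 * a * d) % c = 1 % c then
        ((jacobiSym (2 * (d : ℤ)) c : ℤ) : ℂ) ^ 3 *
          ee (((n * (2 * a : ℕ) + 0 * d : ℤ) : ℂ) / (2 * (c : ℕ))) else 0 else 0) =
      ∑ d ∈ Finset.range c, if (2 * a * (2 * d)) % c = 1 % c then
        ((jacobiSym (2 * ((2 * d : ℕ) : ℤ)) c : ℤ) : ℂ) ^ 3 *
          ee (((n * (2 * a : ℕ) + 0 * (2 * d : ℕ) : ℤ) : ℂ) / (2 * (c : ℕ))) else 0 :=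
    fun a => sum_range_two_mul_even (fun d => if (2 * a * d) % c = 1 % c then
        ((jacobiSym (2 * (d : ℤ)) c : ℤ) : ℂ) ^ 3 *
          ee (((n * (2 * a : ℕ) + 0 * d : ℤ) : ℂ) / (2 * (c : ℕ))) else 0) c
  simp only [hred]
  rw [Finset.sum_congr rfl hinner, ← Finset.mul_sum, ← reducedSum_eq_sum_gaussQuad,
    reducedSum_eq n hc0]
  have hcc : (c : ℂ) = √c ^ 2 := by
    norm_cast
    rw [Real.sq_sqrt (Nat.cast_nonneg _)]
  have e4 := epsFactor_pow_four c
  rw [show (c : ℂ) * rootMoebius n c = √c ^ 2 * rootMoebius n c by rw [← hcc]]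
  rw [show ((3 : ℕ) : ℂ) = 3 by norm_num]
  field_simp
  linear_combination (-(ee (3 / 8) * rootMoebius n c : ℂ)) * e4

theorem rootCount_eq_card_zmod (n : ℤ) (d : ℕ) [NeZero d] :
    rootCount n d = (Fintype.card {x : ZMod d // x ^ 2 + n = 0} : ℤ) := by
  rw [rootCount_apply, Fintype.card_subtype, Finset.card_filter, Finset.card_filter,
    sum_zmod_eq_sum_range]
  congr 1
  refine Finset.sum_congr rfl fun x _ => ?_
  refine if_congr ?_ rfl rfl
  rw [← ZMod.intCast_zmod_eq_zero_iff_dvd]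
  push_cast; rfl

theorem rootCount_one (n : ℤ) : rootCount n 1 = 1 := by
  rw [rootCount_apply]; simp

theorem rootCount_isMultiplicative (n : ℤ) : (rootCount n).IsMultiplicative := by
  refine ArithmeticFunction.IsMultiplicative.iff_ne_zero.mpr ⟨rootCount_one n, ?_⟩
  intro c d hc hd h
  have : NeZero c := ⟨hc⟩
  have : NeZero d := ⟨hd⟩
  have : NeZero (c * d) := ⟨mul_ne_zero hc hd⟩
  rw [rootCount_eq_card_zmod, rootCount_eq_card_zmod, rootCount_eq_card_zmod, ← Nat.cast_mul,
    ← Fintype.card_prod]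
  congr 1
  let φ := ZMod.chineseRemainder h
  have e : ∀ x : ZMod (c * d), x ^ 2 + n = 0 ↔
      (φ x).1 ^ 2 + (n : ZMod c) = 0 ∧ (φ x).2 ^ 2 + (n : ZMod d) = 0 := by
    intro x
    rw [← map_eq_zero_iff φ φ.injective, map_add, map_pow, map_intCast, Prod.ext_iff]
    rfl
  exact Fintype.card_congr ((φ.toEquiv.subtypeEquiv (q := fun y : ZMod c × ZMod d =>
    y.1 ^ 2 + (n : ZMod c) = 0 ∧ y.2 ^ 2 + (n : ZMod d) = 0) e).trans
    (Equiv.subtypeProdEquivProd (p := fun y : ZMod c => y ^ 2 + (n : ZMod c) = 0)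
      (q := fun y : ZMod d => y ^ 2 + (n : ZMod d) = 0)))

theorem rootMoebius_isMultiplicative (n : ℤ) : (rootMoebius n).IsMultiplicative :=
  ArithmeticFunction.isMultiplicative_moebius.mul (rootCount_isMultiplicative n)

theorem sum_rootMoebius_prime_pow (n : ℤ) {p : ℕ} (hp : p.Prime) (k : ℕ) :
    ∑ i ∈ Finset.range (k + 1), rootMoebius n (p ^ i) = rootCount n (p ^ k) := by
  have h : rootMoebius n * (ArithmeticFunction.zeta : ArithmeticFunction ℤ) = rootCount n := by
    rw [rootMoebius, mul_comm, ← mul_assoc, ArithmeticFunction.coe_zeta_mul_moebius, one_mul]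
  rw [← h, ArithmeticFunction.coe_mul_zeta_apply, Nat.sum_divisors_prime_pow hp]

theorem rootMoebius_prime_pow_succ (n : ℤ) {p : ℕ} (hp : p.Prime) (k : ℕ) :
    rootMoebius n (p ^ (k + 1)) = rootCount n (p ^ (k + 1)) - rootCount n (p ^ k) := by
  rw [← sum_rootMoebius_prime_pow n hp, ← sum_rootMoebius_prime_pow n hp,
    Finset.sum_range_succ _ (k + 1), add_sub_cancel_left]

theorem rootMoebius_one (n : ℤ) : rootMoebius n 1 = 1 := (rootMoebius_isMultiplicative n).map_one

theorem rootMoebius_two (n : ℤ) : rootMoebius n 2 = 0 := by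
  have h := rootMoebius_prime_pow_succ n Nat.prime_two 0
  rw [zero_add, pow_one, pow_zero, rootCount_one] at h
  rw [h, rootCount_apply, Finset.card_filter]
  simp only [Finset.sum_range_succ, Finset.sum_range_zero]
  rcases Int.even_or_odd' n with ⟨k, rfl | rfl⟩
  · rw [if_pos (by simp), if_neg (by push_cast; omega)]; rfl
  · rw [if_neg (by push_cast; omega), if_pos (by push_cast; omega)]; rfl

theorem rootMoebius_two_mul_odd (n : ℤ) {c : ℕ} (hc : Odd c) : rootMoebius n (2 * c) = 0 := by
  rw [(rootMoebius_isMultiplicative n).map_mul_of_coprime ((Nat.coprime_two_left).mpr hc),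
    rootMoebius_two, zero_mul]

theorem card_filter_dvd_sub_le_one (r : ℤ) (d : ℕ) :
    ((Finset.range d).filter fun y : ℕ => (d : ℤ) ∣ y - r).card ≤ 1 := by
  rw [Finset.card_le_one]
  intro a ha b hb
  simp only [Finset.mem_filter, Finset.mem_range] at ha hb
  have h := dvd_sub ha.2 hb.2
  rw [sub_sub_sub_cancel_right] at h
  have h1 := Int.eq_zero_of_abs_lt_dvd h (by rw [abs_lt]; constructor <;> omega)
  omega

theorem exists_pow_dvd_of_pow_dvd_mul {p : ℕ} (hp : p.Prime) {k : ℕ} {a b : ℤ}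
    (h : (p : ℤ) ^ k ∣ a * b) : ∃ i j, i + j = k ∧ (p : ℤ) ^ i ∣ a ∧ (p : ℤ) ^ j ∣ b := by
  have h' : p ^ k ∣ a.natAbs * b.natAbs := by
    rw [← Int.natAbs_mul, ← Int.natCast_dvd]; exact_mod_cast h
  obtain ⟨u, v, hu, hv, huv⟩ := exists_dvd_and_dvd_of_dvd_mul h'
  obtain ⟨i, hi, rfl⟩ := (Nat.dvd_prime_pow hp).mp (Dvd.intro v huv.symm)
  obtain ⟨j, hj, rfl⟩ := (Nat.dvd_prime_pow hp).mp (Dvd.intro_left _ huv.symm)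
  refine ⟨i, j, ?_, ?_, ?_⟩
  · rw [← pow_add] at huv
    exact (Nat.pow_right_injective hp.two_le huv).symm
  · have := Int.natCast_dvd.mpr hu; exact_mod_cast this
  · have := Int.natCast_dvd.mpr hv; exact_mod_cast this

theorem rootCount_prime_pow_le {n : ℤ} (hn : n ≠ 0) {p : ℕ} (hp : p.Prime) :
    ∃ C : ℕ, ∀ k, rootCount n (p ^ k) ≤ C := by
  set v := (4 * n).natAbs with hv
  have hv0 : ¬ (p : ℤ) ^ v ∣ 4 * n := by
    intro h
    have h1 : p ^ v ∣ (4 * n).natAbs := by rw [← Int.natCast_dvd]; exact_mod_cast h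
    have h2 := Nat.le_of_dvd (by omega) h1
    have h3 := Nat.lt_pow_self hp.one_lt (n := v)
    omega
  refine ⟨p ^ v + p ^ v, fun k => ?_⟩
  rw [rootCount_apply]
  refine Nat.cast_le.mpr ?_
  rcases Finset.eq_empty_or_nonempty ((Finset.range (p ^ k)).filter fun x : ℕ =>
    ((p ^ k : ℕ) : ℤ) ∣ (x : ℤ) ^ 2 + n) with he | ⟨x, hx⟩
  · rw [he]; simp
  have hx2 : (p : ℤ) ^ k ∣ (x : ℤ) ^ 2 + n := by exact_mod_cast (Finset.mem_filter.mp hx).2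
  have hcard : ∀ r : ℤ, ((Finset.range (p ^ k)).filter fun y : ℕ =>
      ((p ^ (k - v) : ℕ) : ℤ) ∣ y - r).card ≤ p ^ v := by
    intro r
    have : p ^ k = p ^ (k - (k - v)) * p ^ (k - v) := by rw [← pow_add]; congr 1; omega
    rw [this, card_filter_range_mul]
    · calc _ ≤ p ^ (k - (k - v)) * 1 := Nat.mul_le_mul_left _ (card_filter_dvd_sub_le_one r _)
        _ ≤ p ^ v := by rw [mul_one]; exact Nat.pow_le_pow_right hp.pos (by omega)
    · intro y
      rw [show ((y + p ^ (k - v) : ℕ) : ℤ) - r = (p ^ (k - v) : ℕ) + (y - r) by push_cast; ring]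
      exact Int.dvd_add_right (dvd_refl _)
  refine (Finset.card_le_card (t := ((Finset.range (p ^ k)).filter fun y : ℕ =>
      ((p ^ (k - v) : ℕ) : ℤ) ∣ y - x) ∪ ((Finset.range (p ^ k)).filter fun y : ℕ =>
      ((p ^ (k - v) : ℕ) : ℤ) ∣ y - (-x))) ?_).trans
    ((Finset.card_union_le _ _).trans (add_le_add (hcard _) (hcard _)))
  intro y hy
  obtain ⟨hyr, hy2⟩ := Finset.mem_filter.mp hy
  have hy2' : (p : ℤ) ^ k ∣ (y : ℤ) ^ 2 + n := by exact_mod_cast hy2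
  have hprod : (p : ℤ) ^ k ∣ ((y : ℤ) - x) * (y + x) := by
    have := dvd_sub hy2' hx2
    exact this.trans (dvd_of_eq (by ring))
  obtain ⟨i, j, hij, hi, hj⟩ := exists_pow_dvd_of_pow_dvd_mul hp hprod
  rw [Finset.mem_union, Finset.mem_filter, Finset.mem_filter, sub_neg_eq_add]
  push_cast
  by_cases h1 : k - v ≤ i
  · exact Or.inl ⟨hyr, (pow_dvd_pow _ h1).trans hi⟩
  by_cases h2 : k - v ≤ j
  · exact Or.inr ⟨hyr, (pow_dvd_pow _ h2).trans hj⟩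
  exfalso
  apply hv0
  have hi' : (p : ℤ) ^ v ∣ (y : ℤ) - x := (pow_dvd_pow _ (by omega)).trans hi
  have hj' : (p : ℤ) ^ v ∣ (y : ℤ) + x := (pow_dvd_pow _ (by omega)).trans hj
  have hk' : (p : ℤ) ^ v ∣ (x : ℤ) ^ 2 + n := (pow_dvd_pow _ (by omega)).trans hx2
  have := dvd_sub (hk'.mul_left 4) ((dvd_sub hj' hi').mul_left (2 * x))
  exact this.trans (dvd_of_eq (by ring))

theorem int_coprime_two_mul {p : ℕ} (hp : p.Prime) (hp2 : p ≠ 2) {n : ℤ}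
    (hpn : ¬ (p : ℤ) ∣ n) {x : ℤ} (hx : (p : ℤ) ∣ x ^ 2 + n) : ¬ (p : ℤ) ∣ 2 * x := by
  have hpI := Nat.prime_iff_prime_int.mp hp
  intro h
  rcases hpI.dvd_or_dvd h with h | h
  · have : p ∣ 2 := by exact_mod_cast h
    exact hp2 ((Nat.prime_dvd_prime_iff_eq hp Nat.prime_two).mp this)
  · exact hpn ((Int.dvd_add_right (h.mul_left x)).mp (by rwa [← sq]))

theorem rootCount_prime_pow_succ {n : ℤ} {p : ℕ} (hp : p.Prime) (hp2 : p ≠ 2)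
    (hpn : ¬ (p : ℤ) ∣ n) (k : ℕ) :
    rootCount n (p ^ (k + 2)) = rootCount n (p ^ (k + 1)) := by
  have hpI := Nat.prime_iff_prime_int.mp hp
  rw [rootCount_apply, rootCount_apply]
  congr 1
  have hmod : ∀ y : ℕ, ∃ t : ℤ, ((y % p ^ (k + 1) : ℕ) : ℤ) = y + (p : ℤ) ^ (k + 1) * t := by
    intro y
    refine ⟨-(y / p ^ (k + 1) : ℕ), ?_⟩
    have := Nat.mod_add_div y (p ^ (k + 1))
    zify at this ⊢
    linear_combination this
  refine Finset.card_bij (fun y _ => y % p ^ (k + 1)) ?_ ?_ ?_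
  · intro y hy
    obtain ⟨_, hy⟩ := Finset.mem_filter.mp hy
    refine Finset.mem_filter.mpr ⟨Finset.mem_range.mpr (Nat.mod_lt _ (pow_pos hp.pos _)), ?_⟩
    obtain ⟨t, ht⟩ := hmod y
    rw [ht]
    push_cast at hy ⊢
    have h1 : (p : ℤ) ^ (k + 1) ∣ y ^ 2 + n := (pow_dvd_pow _ (by omega)).trans hy
    have h2 := dvd_add h1 (dvd_mul_right ((p : ℤ) ^ (k + 1)) (t * (2 * y + p ^ (k + 1) * t)))
    exact h2.trans (dvd_of_eq (by ring))
  · intro y hy z hz hyz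
    obtain ⟨hyr, hy⟩ := Finset.mem_filter.mp hy
    obtain ⟨hzr, hz⟩ := Finset.mem_filter.mp hz
    have hyzd : (p : ℤ) ^ (k + 1) ∣ (y : ℤ) - z := by
      have : ((p ^ (k + 1) : ℕ) : ℤ) ∣ (y : ℤ) - z := Nat.modEq_iff_dvd.mp (Eq.symm hyz)
      exact_mod_cast this
    have h1 : (p : ℤ) ^ (k + 2) ∣ ((y : ℤ) - z) * (y + z) := by
      have := dvd_sub hy hz
      push_cast at this
      exact this.trans (dvd_of_eq (by ring))
    have h2 : ¬ (p : ℤ) ∣ y + z := by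
      intro h
      have hpy : (p : ℤ) ∣ (y : ℤ) ^ 2 + n := by
        refine dvd_trans ?_ hy
        push_cast
        exact dvd_pow_self _ (by omega)
      apply int_coprime_two_mul hp hp2 hpn hpy
      have := dvd_add h ((dvd_pow_self (p : ℤ) (Nat.succ_ne_zero k)).trans hyzd)
      exact this.trans (dvd_of_eq (by ring))
    have h3 := hpI.pow_dvd_of_dvd_mul_right (k + 2) h2 h1
    have h4 := Int.eq_zero_of_abs_lt_dvd h3 (by
      rw [Finset.mem_range] at hyr hzr
      zify at hyr hzr
      rw [abs_lt]; constructor <;> omega)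
    omega
  · intro x hx
    obtain ⟨hxr, hx⟩ := Finset.mem_filter.mp hx
    push_cast at hx
    have hpx : (p : ℤ) ∣ (x : ℤ) ^ 2 + n := (dvd_pow_self _ (Nat.succ_ne_zero k)).trans hx
    have h2 := int_coprime_two_mul hp hp2 hpn hpx
    obtain ⟨q, hq⟩ := hx
    obtain ⟨a, b, hab⟩ := (Int.isCoprime_iff_gcd_eq_one.mpr
      ((Int.isCoprime_iff_gcd_eq_one.mp ((Prime.coprime_iff_not_dvd hpI).mpr h2))))
    let z : ℤ := x + p ^ (k + 1) * (-(q * b))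
    have hz : (p : ℤ) ^ (k + 2) ∣ z ^ 2 + n := by
      refine ⟨q * a + p ^ k * (q * b) ^ 2, ?_⟩
      simp only [z]
      linear_combination hq - (p : ℤ) ^ (k + 1) * q * hab
    have hP : (0 : ℤ) < p ^ (k + 2) := by have := hp.pos; positivity
    have hw0 := Int.emod_nonneg z hP.ne'
    have hwlt := Int.emod_lt_of_pos z hP
    obtain ⟨y, hy⟩ := Int.eq_ofNat_of_zero_le hw0
    have hyz : (y : ℤ) = z - p ^ (k + 2) * (z / p ^ (k + 2)) := by
      rw [← hy]; exact Int.emod_def _ _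
    refine ⟨y, Finset.mem_filter.mpr ⟨Finset.mem_range.mpr ?_, ?_⟩, ?_⟩
    · zify; rw [← hy]; exact hwlt
    · push_cast
      rw [hyz]
      have := dvd_add hz (dvd_mul_right ((p : ℤ) ^ (k + 2))
        (-2 * z * (z / p ^ (k + 2)) + p ^ (k + 2) * (z / p ^ (k + 2)) ^ 2))
      exact this.trans (dvd_of_eq (by ring))
    · rw [← Nat.mod_eq_of_lt (Finset.mem_range.mp hxr)]
      have : y ≡ x [MOD p ^ (k + 1)] := by
        rw [Nat.modEq_iff_dvd, hyz]
        refine ⟨q * b + p * (z / p ^ (k + 2)), ?_⟩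
        simp only [z]
        push_cast
        ring
      exact this

theorem rootCount_prime {n : ℤ} {p : ℕ} [Fact p.Prime] (hp2 : p ≠ 2) :
    rootCount n p = legendreSym p (-n) + 1 := by
  have := quadraticChar_card_sqrts (F := ZMod p) (by rwa [ZMod.ringChar_zmod_n]) ((-n : ℤ) : ZMod p)
  rw [legendreSym, ← this, rootCount_eq_card_zmod, Fintype.card_subtype]
  congr 2
  ext x
  simp [eq_neg_iff_add_eq_zero]

theorem rootMoebius_prime {n : ℤ} {p : ℕ} [Fact p.Prime] (hp2 : p ≠ 2) :
    rootMoebius n p = jacobiSym (-n) p := by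
  have h := rootMoebius_prime_pow_succ n (Fact.out : p.Prime) 0
  rw [zero_add, pow_one, pow_zero, rootCount_one, rootCount_prime hp2] at h
  rw [h, ← jacobiSym.legendreSym.to_jacobiSym]; ring

theorem rootMoebius_prime_pow_eq_zero {n : ℤ} {p : ℕ} (hp : p.Prime) (hp2 : p ≠ 2)
    (hpn : ¬ (p : ℤ) ∣ n) (k : ℕ) : rootMoebius n (p ^ (k + 2)) = 0 := by
  rw [rootMoebius_prime_pow_succ n hp (k + 1), rootCount_prime_pow_succ hp hp2 hpn, sub_self]

theorem ArithmeticFunction.IsMultiplicative.exists_abs_le {f : ArithmeticFunction ℤ}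
    (hf : f.IsMultiplicative) (S : Finset ℕ)
    (h1 : ∀ p, p.Prime → p ∉ S → ∀ k, |f (p ^ k)| ≤ 1)
    (h2 : ∀ p, p.Prime → ∃ B : ℕ, ∀ k, |f (p ^ k)| ≤ B) : ∃ K : ℕ, ∀ c, |f c| ≤ K := by
  choose! B hB using h2
  refine ⟨∏ p ∈ S, max 1 (B p), fun c => ?_⟩
  rcases eq_or_ne c 0 with rfl | hc
  · rw [f.map_zero, abs_zero]; exact Nat.cast_nonneg _
  rw [hf.multiplicative_factorization f hc, Finsupp.prod, Finset.abs_prod]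
  have hle : ∀ p ∈ c.factorization.support, |f (p ^ c.factorization p)| ≤
      ((if p ∈ S then max 1 (B p) else 1 : ℕ) : ℤ) := by
    intro p hp
    have hpp : p.Prime := Nat.prime_of_mem_primeFactors (by simpa using hp)
    split_ifs with h
    · exact (hB p hpp _).trans (by exact_mod_cast le_max_right _ _)
    · exact_mod_cast h1 p hpp h _
  refine (Finset.prod_le_prod (fun _ _ => abs_nonneg _) hle).trans ?_
  rw [← Nat.cast_prod]
  refine Nat.cast_le.mpr ?_
  rw [← Finset.prod_filter]
  refine Finset.prod_le_prod_of_subset_of_one_le' ?_ fun p _ _ => le_max_left _ _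
  intro p hp
  exact (Finset.mem_filter.mp hp).2

theorem rootMoebius_prime_pow_bounded {n : ℤ} (hn : n ≠ 0) {p : ℕ} (hp : p.Prime) :
    ∃ B : ℕ, ∀ k, |rootMoebius n (p ^ k)| ≤ B := by
  obtain ⟨C, hC⟩ := rootCount_prime_pow_le hn hp
  have h0 : ∀ k, 0 ≤ rootCount n (p ^ k) := fun k => by rw [rootCount_apply]; positivity
  refine ⟨max 1 C, fun k => ?_⟩
  rcases k with _ | k
  · rw [pow_zero, rootMoebius_one]; simp
  · rw [rootMoebius_prime_pow_succ n hp]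
    push_cast
    refine le_max_of_le_right ?_
    have := hC k; have := hC (k + 1); have := h0 k; have := h0 (k + 1)
    rw [abs_le]; constructor <;> linarith

theorem abs_jacobiSym_le_one (a : ℤ) (b : ℕ) : |jacobiSym a b| ≤ 1 := by
  rcases jacobiSym.trichotomy a b with h | h | h <;> rw [h] <;> simp

theorem rootMoebius_bounded {n : ℤ} (hn : n ≠ 0) : ∃ K : ℕ, ∀ c, |rootMoebius n c| ≤ K := by
  refine (rootMoebius_isMultiplicative n).exists_abs_le (2 * n.natAbs).primeFactors ?_
    (fun p hp => rootMoebius_prime_pow_bounded hn hp)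
  intro p hp hpS k
  have h2 : ¬ p ∣ 2 * n.natAbs := fun h =>
    hpS (Nat.mem_primeFactors.mpr ⟨hp, h, by simpa using hn⟩)
  have hp2 : p ≠ 2 := by rintro rfl; exact h2 (dvd_mul_right _ _)
  have hpn : ¬ (p : ℤ) ∣ n := fun h => h2 ((Int.natCast_dvd.mp h).mul_left 2)
  have : Fact p.Prime := ⟨hp⟩
  rcases k with _ | _ | k
  · rw [pow_zero, rootMoebius_one]; simp
  · rw [zero_add, pow_one, rootMoebius_prime hp2]; exact abs_jacobiSym_le_one _ _
  · rw [rootMoebius_prime_pow_eq_zero hp hp2 hpn]; simp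

/-- The number of `k ≤ K`, `k ≥ 1`, with `p ^ k ∣ y`. -/
def powDvdCount (p K : ℕ) (y : ℤ) : ℕ :=
  ((Finset.range K).filter fun k => ((p ^ (k + 1) : ℕ) : ℤ) ∣ y).card

theorem powDvdCount_le (p K : ℕ) (y : ℤ) : powDvdCount p K y ≤ K :=
  (Finset.card_filter_le _ _).trans (Finset.card_range K).le

theorem powDvdCount_eq_min {p : ℕ} [Fact p.Prime] (K : ℕ) {y : ℤ} (hy : y ≠ 0) :
    powDvdCount p K y = min K (padicValInt p y) := by
  rw [powDvdCount, ← Finset.card_range (min K (padicValInt p y))]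
  congr 1
  ext k
  rw [Finset.mem_filter, Finset.mem_range, Finset.mem_range]
  push_cast
  rw [padicValInt_dvd_iff]
  simp only [hy, false_or]
  omega

theorem powDvdCount_mul {p : ℕ} [Fact p.Prime] {K : ℕ} {a b : ℤ} (h : ¬ (p : ℤ) ^ K ∣ a * b) :
    powDvdCount p K (a * b) = powDvdCount p K a + powDvdCount p K b := by
  have hab : a * b ≠ 0 := fun h0 => h (by rw [h0]; exact dvd_zero _)
  have ha := left_ne_zero_of_mul hab
  have hb := right_ne_zero_of_mul hab
  rw [powDvdCount_eq_min K hab, powDvdCount_eq_min K ha, powDvdCount_eq_min K hb]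
  rw [padicValInt_dvd_iff, not_or, padicValInt.mul ha hb] at h
  rw [padicValInt.mul ha hb]
  omega

theorem sum_powDvdCount (p K : ℕ) (g : ℕ → ℤ) :
    ∑ x ∈ Finset.range (p ^ K), powDvdCount p K (g x) = ∑ k ∈ Finset.range K,
      ((Finset.range (p ^ K)).filter fun x => ((p ^ (k + 1) : ℕ) : ℤ) ∣ g x).card := by
  simp only [powDvdCount, Finset.card_filter]
  exact Finset.sum_comm

theorem card_filter_dvd_sub (r : ℤ) {d : ℕ} (hd : 0 < d) :
    ((Finset.range d).filter fun y : ℕ => (d : ℤ) ∣ y - r).card = 1 := by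
  refine le_antisymm (card_filter_dvd_sub_le_one r d) (Finset.card_pos.mpr ?_)
  have hd' : (0 : ℤ) < d := by exact_mod_cast hd
  refine ⟨(r % d).toNat, Finset.mem_filter.mpr ⟨Finset.mem_range.mpr ?_, ?_⟩⟩
  · have := Int.emod_lt_of_pos r hd'; have := Int.emod_nonneg r hd'.ne'; omega
  · rw [Int.toNat_of_nonneg (Int.emod_nonneg r hd'.ne')]
    exact ⟨-(r / d), by rw [Int.emod_def]; ring⟩

theorem sum_powDvdCount_sub {p : ℕ} (hp : p.Prime) (K : ℕ) (r : ℤ) :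
    ((∑ x ∈ Finset.range (p ^ K), powDvdCount p K (x - r) : ℕ) : ℝ) =
      p ^ K * ∑ k ∈ Finset.range K, ((p : ℝ)⁻¹) ^ (k + 1) := by
  rw [sum_powDvdCount, Nat.cast_sum, Finset.mul_sum]
  refine Finset.sum_congr rfl fun k hk => ?_
  have hk := Finset.mem_range.mp hk
  have hpk : p ^ K = p ^ (K - (k + 1)) * p ^ (k + 1) := by rw [← pow_add]; congr 1; omega
  rw [hpk, card_filter_range_mul, card_filter_dvd_sub r (pow_pos hp.pos _), mul_one]
  · have : (p : ℝ) ≠ 0 := by exact_mod_cast hp.ne_zero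
    have hpk' : (p : ℝ) ^ K = p ^ (K - (k + 1)) * p ^ (k + 1) := by exact_mod_cast hpk
    rw [hpk', mul_assoc, ← mul_pow, mul_inv_cancel₀ this, one_pow, mul_one]
    push_cast; rfl
  · intro y
    rw [show ((y + p ^ (k + 1) : ℕ) : ℤ) - r = (p ^ (k + 1) : ℕ) + (y - r) by push_cast; ring]
    exact Int.dvd_add_right (dvd_refl _)

theorem sum_powDvdCount_sq {p : ℕ} (hp : p.Prime) (K : ℕ) (n : ℤ) :
    ((∑ x ∈ Finset.range (p ^ K), powDvdCount p K ((x : ℤ) ^ 2 + n) : ℕ) : ℝ) =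
      p ^ K * ∑ k ∈ Finset.range K, (rootCount n (p ^ (k + 1)) : ℝ) * ((p : ℝ)⁻¹) ^ (k + 1) := by
  rw [sum_powDvdCount, Nat.cast_sum, Finset.mul_sum]
  refine Finset.sum_congr rfl fun k hk => ?_
  have hk := Finset.mem_range.mp hk
  have hpk : p ^ K = p ^ (K - (k + 1)) * p ^ (k + 1) := by rw [← pow_add]; congr 1; omega
  rw [hpk, card_filter_range_mul (fun x => dvd_sq_add_periodic n _ x), rootCount_apply]
  have : (p : ℝ) ≠ 0 := by exact_mod_cast hp.ne_zero
  have hpk' : (p : ℝ) ^ K = p ^ (K - (k + 1)) * p ^ (k + 1) := by exact_mod_cast hpk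
  rw [hpk', inv_pow]
  push_cast
  field_simp

theorem abs_sum_powDvdCount_sub_le {p : ℕ} (hp : p.Prime) (K : ℕ) (m : ℤ) :
    |((∑ x ∈ Finset.range (p ^ K), powDvdCount p K ((x : ℤ) ^ 2 + -m ^ 2) : ℕ) : ℝ) -
      ((∑ x ∈ Finset.range (p ^ K), powDvdCount p K (x - m) : ℕ) : ℝ) -
      ((∑ x ∈ Finset.range (p ^ K), powDvdCount p K (x - -m) : ℕ) : ℝ)| ≤
      2 * K * rootCount (-m ^ 2) (p ^ K) := by
  have : Fact p.Prime := ⟨hp⟩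
  push_cast
  rw [← Finset.sum_sub_distrib, ← Finset.sum_sub_distrib, rootCount_apply, Finset.card_filter]
  push_cast
  rw [Finset.mul_sum]
  refine (Finset.abs_sum_le_sum_abs _ _).trans (Finset.sum_le_sum fun x _ => ?_)
  have hfac : (x : ℤ) ^ 2 + -m ^ 2 = (x - m) * (x - -m) := by ring
  split_ifs with h
  · have h1 : (powDvdCount p K ((x : ℤ) ^ 2 + -m ^ 2) : ℝ) ≤ K := by
      exact_mod_cast powDvdCount_le _ _ _
    have h2 : (powDvdCount p K ((x : ℤ) - m) : ℝ) ≤ K := by exact_mod_cast powDvdCount_le _ _ _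
    have h3 : (powDvdCount p K ((x : ℤ) - -m) : ℝ) ≤ K := by exact_mod_cast powDvdCount_le _ _ _
    have h4 : (0 : ℝ) ≤ powDvdCount p K ((x : ℤ) ^ 2 + -m ^ 2) := Nat.cast_nonneg _
    have h5 : (0 : ℝ) ≤ powDvdCount p K ((x : ℤ) - m) := Nat.cast_nonneg _
    have h6 : (0 : ℝ) ≤ powDvdCount p K ((x : ℤ) - -m) := Nat.cast_nonneg _
    rw [abs_le]; constructor <;> linarith
  · rw [hfac] at h ⊢
    rw [powDvdCount_mul h]
    push_cast
    rw [show ∀ a b : ℝ, a + b - a - b = 0 by intros; ring]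
    simp

theorem tendsto_sum_rootCount {p : ℕ} (hp : p.Prime) {m : ℤ} (hm : m ≠ 0) :
    Tendsto (fun K => ∑ k ∈ Finset.range K,
      (rootCount (-m ^ 2) (p ^ (k + 1)) : ℝ) * ((p : ℝ)⁻¹) ^ (k + 1)) atTop
      (𝓝 (2 * (1 / (p - 1)))) := by
  obtain ⟨C, hC⟩ := rootCount_prime_pow_le (n := -m ^ 2) (by simpa using hm) hp
  have hp1 : (1 : ℝ) < p := by exact_mod_cast hp.one_lt
  have hp0 : (0 : ℝ) < p := by positivity
  have hinv : (p : ℝ)⁻¹ < 1 := inv_lt_one_of_one_lt₀ hp1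
  have hA : Tendsto (fun K => ∑ k ∈ Finset.range K, ((p : ℝ)⁻¹) ^ (k + 1)) atTop
      (𝓝 (1 / (p - 1))) := by
    have h := ((hasSum_geometric_of_lt_one (inv_nonneg.mpr hp0.le) hinv).mul_right
      (p : ℝ)⁻¹).tendsto_sum_nat
    simp only [← pow_succ] at h
    convert h using 2
    have : (p : ℝ) - 1 ≠ 0 := by linarith
    field_simp
  have hB : Tendsto (fun K : ℕ => 2 * (C : ℝ) * (K * ((p : ℝ)⁻¹) ^ K)) atTop (𝓝 0) := by
    have := tendsto_self_mul_const_pow_of_lt_one (inv_nonneg.mpr hp0.le) hinv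
    simpa using this.const_mul (2 * (C : ℝ))
  have hdiff : Tendsto (fun K => (∑ k ∈ Finset.range K,
      (rootCount (-m ^ 2) (p ^ (k + 1)) : ℝ) * ((p : ℝ)⁻¹) ^ (k + 1)) -
      2 * ∑ k ∈ Finset.range K, ((p : ℝ)⁻¹) ^ (k + 1)) atTop (𝓝 0) := by
    refine squeeze_zero_norm (fun K => ?_) hB
    have h := abs_sum_powDvdCount_sub_le hp K m
    rw [sum_powDvdCount_sub hp, sum_powDvdCount_sub hp, sum_powDvdCount_sq hp] at h
    have hpK : (0 : ℝ) < p ^ K := by positivity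
    set S := ∑ k ∈ Finset.range K, (rootCount (-m ^ 2) (p ^ (k + 1)) : ℝ) * ((p : ℝ)⁻¹) ^ (k + 1)
    set A := ∑ k ∈ Finset.range K, ((p : ℝ)⁻¹) ^ (k + 1)
    rw [show (p : ℝ) ^ K * S - p ^ K * A - p ^ K * A = p ^ K * (S - 2 * A) by ring, abs_mul,
      abs_of_pos hpK] at h
    have hCK : (rootCount (-m ^ 2) (p ^ K) : ℝ) ≤ C := by exact_mod_cast hC K
    rw [Real.norm_eq_abs, inv_pow]
    have h2 : (p : ℝ) ^ K * |S - 2 * A| ≤ 2 * K * C :=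
      h.trans (mul_le_mul_of_nonneg_left hCK (by positivity))
    calc |S - 2 * A| ≤ 2 * K * C / p ^ K := by rw [le_div_iff₀ hpK]; linarith
      _ = _ := by field_simp
  have := hdiff.add (hA.const_mul 2)
  simpa using this

theorem summable_rootMoebius_prime_pow {n : ℤ} (hn : n ≠ 0) {p : ℕ} (hp : p.Prime) :
    Summable fun k : ℕ => (rootMoebius n (p ^ k) : ℝ) * ((p : ℝ)⁻¹) ^ k := by
  obtain ⟨B, hB⟩ := rootMoebius_prime_pow_bounded hn hp
  have hp1 : (1 : ℝ) < p := by exact_mod_cast hp.one_lt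
  have hp0 : (0 : ℝ) ≤ (p : ℝ)⁻¹ := by positivity
  refine Summable.of_norm_bounded
    ((summable_geometric_of_lt_one hp0 (inv_lt_one_of_one_lt₀ hp1)).mul_left (B : ℝ)) fun k => ?_
  rw [norm_mul, norm_pow, Real.norm_of_nonneg hp0]
  refine mul_le_mul_of_nonneg_right ?_ (pow_nonneg hp0 k)
  rw [Real.norm_eq_abs]
  exact_mod_cast hB k

theorem hasSum_rootMoebius_prime_pow {p : ℕ} (hp : p.Prime) {m : ℤ} (hm : m ≠ 0) :
    HasSum (fun k : ℕ => (rootMoebius (-m ^ 2) (p ^ k) : ℝ) * ((p : ℝ)⁻¹) ^ k)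
      (1 + (p : ℝ)⁻¹) := by
  have hsum := summable_rootMoebius_prime_pow (n := -m ^ 2) (by simpa using hm) hp
  have h1 := hsum.hasSum.tendsto_sum_nat
  have hS := tendsto_sum_rootCount hp hm
  set S : ℕ → ℝ := fun K => ∑ k ∈ Finset.range K,
      (rootCount (-m ^ 2) (p ^ (k + 1)) : ℝ) * ((p : ℝ)⁻¹) ^ (k + 1) with hSdef
  have hp1 : (1 : ℝ) < p := by exact_mod_cast hp.one_lt
  have key : ∀ K, ∑ k ∈ Finset.range (K + 2),
      (rootMoebius (-m ^ 2) (p ^ k) : ℝ) * ((p : ℝ)⁻¹) ^ k =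
      1 + S (K + 1) - (p : ℝ)⁻¹ * (1 + S K) := by
    intro K
    rw [Finset.sum_range_succ', pow_zero, rootMoebius_one]
    have h2 : ∀ k, (rootMoebius (-m ^ 2) (p ^ (k + 1)) : ℝ) * ((p : ℝ)⁻¹) ^ (k + 1) =
        (rootCount (-m ^ 2) (p ^ (k + 1)) : ℝ) * ((p : ℝ)⁻¹) ^ (k + 1) -
        (p : ℝ)⁻¹ * ((rootCount (-m ^ 2) (p ^ k) : ℝ) * ((p : ℝ)⁻¹) ^ k) := by
      intro k
      rw [rootMoebius_prime_pow_succ _ hp]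
      push_cast; ring
    simp only [h2]
    rw [Finset.sum_sub_distrib, ← Finset.mul_sum, Finset.sum_range_succ' (fun k =>
      (rootCount (-m ^ 2) (p ^ k) : ℝ) * ((p : ℝ)⁻¹) ^ k) K, pow_zero, rootCount_one]
    simp only [hSdef]
    push_cast; ring
  have h3 := (tendsto_add_atTop_iff_nat 2).mpr h1
  simp only [key] at h3
  have h4 := (((tendsto_add_atTop_iff_nat 1).mpr hS).const_add 1).sub
    ((hS.const_add 1).const_mul (p : ℝ)⁻¹)
  have h5 := tendsto_nhds_unique h3 h4
  convert hsum.hasSum using 1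
  rw [h5]
  have : (p : ℝ) - 1 ≠ 0 := by linarith
  field_simp
  ring

theorem exists_jacobi_character {D : ℤ} (hD : D ≠ 0) :
    ∃ χ : DirichletCharacter ℂ (4 * D.natAbs), ∀ k : ℕ, k.Coprime (4 * D.natAbs) →
      χ k = (jacobiSym D k : ℤ) := by
  classical
  have hM : 0 < D.natAbs := Int.natAbs_pos.mpr hD
  have hne : NeZero (4 * D.natAbs) := ⟨by omega⟩
  have hodd : ∀ k : ℕ, k.Coprime (4 * D.natAbs) → Odd k := fun k hk =>
    Nat.coprime_two_right.mp (hk.coprime_dvd_right (Dvd.intro (2 * D.natAbs) (by ring)))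
  have hval : ∀ a : ZMod (4 * D.natAbs), IsUnit a → a.val.Coprime (4 * D.natAbs) := by
    intro a ha
    rw [← ZMod.natCast_zmod_val a, ZMod.isUnit_iff_coprime] at ha
    simpa using ha
  refine ⟨{ toFun := fun a => if IsUnit a then ((jacobiSym D a.val : ℤ) : ℂ) else 0
            map_one' := ?_
            map_mul' := ?_
            map_nonunit' := fun a ha => if_neg ha }, ?_⟩
  · have : Fact (1 < 4 * D.natAbs) := ⟨by omega⟩
    rw [if_pos isUnit_one, ZMod.val_one, jacobiSym.one_right, Int.cast_one]
  · intro a b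
    by_cases ha : IsUnit a
    · by_cases hb : IsUnit b
      · have h1 := hval a ha
        have h2 := hval b hb
        have ho := (hodd _ h1).mul (hodd _ h2)
        simp only [if_pos ha, if_pos hb, if_pos (ha.mul hb)]
        rw [ZMod.val_mul, ← jacobiSym.mod_right D ho,
          jacobiSym.mul_right' _ (hodd _ h1).pos.ne' (hodd _ h2).pos.ne']
        push_cast; rfl
      · simp [IsUnit.mul_iff, hb]
    · simp [IsUnit.mul_iff, ha]
  · intro k hk
    have hu : IsUnit (k : ZMod (4 * D.natAbs)) := (ZMod.isUnit_iff_coprime _ _).mpr hk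
    change (if IsUnit (k : ZMod (4 * D.natAbs)) then _ else _) = _
    rw [if_pos hu, ZMod.val_natCast, ← jacobiSym.mod_right D (hodd k hk)]

theorem exists_jacobiSym_eq_neg_one_of_odd_prime {D : ℤ} (hD : D ≠ 0) {q b : ℕ} {a : ℤ}
    (hq : q.Prime) (hq2 : q ≠ 2) (ha : ¬ (q : ℤ) ∣ a) (h : D = (b : ℤ) ^ 2 * (q * a)) :
    ∃ k : ℕ, k.Coprime (4 * D.natAbs) ∧ jacobiSym D k = -1 := by
  have hqF : Fact q.Prime := ⟨hq⟩
  have hDpos : 0 < D.natAbs := Int.natAbs_pos.mpr hD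
  have hM0 : 4 * D.natAbs ≠ 0 := by omega
  set N := ordCompl[q] (4 * D.natAbs) with hN
  have hcop : q.Coprime N := Nat.coprime_ordCompl hq hM0
  have hfac : q ^ (4 * D.natAbs).factorization q * N = 4 * D.natAbs :=
    Nat.ordProj_mul_ordCompl_eq_self _ _
  have h4a : 4 * a.natAbs ∣ N := by
    have h1 : (4 * a.natAbs).Coprime (q ^ (4 * D.natAbs).factorization q) := by
      refine Nat.Coprime.pow_right _ (Nat.Coprime.symm ((Nat.Prime.coprime_iff_not_dvd hq).mpr ?_))
      intro hd
      rcases hq.dvd_mul.mp hd with hd | hd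
      · exact hq2 ((Nat.prime_dvd_prime_iff_eq hq Nat.prime_two).mp
          (hq.dvd_of_dvd_pow (show q ∣ 2 ^ 2 from hd)))
      · exact ha (Int.natCast_dvd.mpr hd)
    refine h1.dvd_of_dvd_mul_left ?_
    rw [hfac, h, Int.natAbs_mul, Int.natAbs_mul]
    exact Dvd.intro_left ((b ^ 2 : ℤ).natAbs * q) (by rw [Int.natAbs_natCast]; ring)
  obtain ⟨x, hx⟩ : ∃ x : ZMod q, ¬ IsSquare x :=
    FiniteField.exists_nonsquare (by rw [ZMod.ringChar_zmod_n]; exact hq2)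
  obtain ⟨k, hk1, hk2⟩ := Nat.chineseRemainder hcop x.val 1
  have hkq : (k : ZMod q) = x := by
    rw [(ZMod.natCast_eq_natCast_iff _ _ _).mpr hk1, ZMod.natCast_zmod_val]
  have hJq : jacobiSym k q = -1 := by
    refine ZMod.nonsquare_iff_jacobiSym_eq_neg_one.mpr ?_
    rwa [Int.cast_natCast, hkq]
  have hk4 : k % 4 = 1 := hk2.of_dvd ((dvd_mul_right 4 _).trans h4a)
  have hkodd : Odd k := Nat.odd_iff.mpr (by omega)
  have hkN : k.Coprime N := by
    rw [Nat.Coprime, hk2.gcd_eq, Nat.gcd_one_left]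
  have hkcq : k.Coprime q := by
    refine Nat.Coprime.symm ((Nat.Prime.coprime_iff_not_dvd hq).mpr fun hd => hx ?_)
    rw [← hkq, (ZMod.natCast_eq_zero_iff _ _).mpr hd]
    exact IsSquare.zero
  have hkD : k.Coprime (4 * D.natAbs) := by
    rw [← hfac]
    exact (hkcq.pow_right _).mul_right hkN
  refine ⟨k, hkD, ?_⟩
  have hb : jacobiSym ((b : ℤ) ^ 2) k = 1 := by
    refine jacobiSym.sq_one' ?_
    rw [Int.gcd_natCast_natCast]
    refine Nat.Coprime.symm (hkD.coprime_dvd_right ?_)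
    rw [h, Int.natAbs_mul, Int.natAbs_pow, Int.natAbs_natCast]
    exact Dvd.intro_left (4 * b * (q * a).natAbs) (by ring)
  have ha1 : jacobiSym a k = 1 := by
    have : k % (4 * a.natAbs) = 1 % (4 * a.natAbs) := hk2.of_dvd h4a
    rw [jacobiSym.mod_right a hkodd, this, ← jacobiSym.mod_right a odd_one, jacobiSym.one_right]
  rw [h, jacobiSym.mul_left, jacobiSym.mul_left, hb, ha1,
    jacobiSym.quadratic_reciprocity_one_mod_four' (hq.odd_of_ne_two hq2) hk4, hJq]
  norm_num

theorem exists_jacobiSym_eq_neg_one {D : ℤ} (hD : ¬ IsSquare D) :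
    ∃ k : ℕ, k.Coprime (4 * D.natAbs) ∧ jacobiSym D k = -1 := by
  have hD0 : D ≠ 0 := by rintro rfl; exact hD IsSquare.zero
  have hDpos : 0 < D.natAbs := Int.natAbs_pos.mpr hD0
  obtain ⟨a, b, ha, hb, hab, hsq⟩ := Nat.sq_mul_squarefree_of_pos hDpos
  have hDs : D = (b : ℤ) ^ 2 * (D.sign * a) := by
    conv_lhs => rw [← Int.sign_mul_natAbs D, ← hab]
    push_cast; ring
  have hs : D.sign = 1 ∨ D.sign = -1 := by
    rcases lt_or_gt_of_ne hD0 with h | h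
    · exact Or.inr (Int.sign_eq_neg_one_of_neg h)
    · exact Or.inl (Int.sign_eq_one_of_pos h)
  have hbig : ∀ k : ℕ, k.Prime → 4 * D.natAbs < k → k.Coprime (4 * D.natAbs) := fun k hk hlt =>
    (Nat.Prime.coprime_iff_not_dvd hk).mpr fun h =>
      absurd (Nat.le_of_dvd (by omega) h) (by omega)
  have hbk : ∀ k : ℕ, k.Coprime (4 * D.natAbs) → jacobiSym ((b : ℤ) ^ 2) k = 1 := by
    intro k hk
    refine jacobiSym.sq_one' ?_
    rw [Int.gcd_natCast_natCast]
    refine Nat.Coprime.symm (hk.coprime_dvd_right ?_)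
    rw [← hab]
    exact Dvd.intro_left (4 * b * a) (by ring)
  by_cases hodd : ∃ q, q.Prime ∧ q ≠ 2 ∧ q ∣ a
  · obtain ⟨q, hq, hq2, c, rfl⟩ := hodd
    refine exists_jacobiSym_eq_neg_one_of_odd_prime hD0 hq hq2 (a := D.sign * c) (b := b) ?_ ?_
    · intro hd
      have hqc : q ∣ c := by
        have := Int.natCast_dvd.mp hd
        rwa [Int.natAbs_mul, Int.natAbs_sign_of_ne_zero hD0, one_mul, Int.natAbs_natCast] at this
      exact hq.one_lt.ne' (Nat.isUnit_iff.mp (hsq q (mul_dvd_mul_left q hqc)))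
    · refine hDs.trans ?_
      push_cast; ring
  · push Not at hodd
    have h12 : a = 1 ∨ a = 2 := by
      have hsub : a.primeFactors ⊆ {2} := fun q hq => by
        by_contra h
        exact hodd q (Nat.prime_of_mem_primeFactors hq) (by simpa using h)
          (Nat.dvd_of_mem_primeFactors hq)
      have hprod := Nat.prod_primeFactors_of_squarefree hsq
      rcases Finset.subset_singleton_iff.mp hsub with h | h <;> rw [h] at hprod <;>
        simp at hprod <;> omega
    rcases h12 with rfl | rfl
    · rcases hs with hs | hs
      · refine absurd ⟨(b : ℤ), ?_⟩ hD
        rw [hDs, hs]; ring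
      · obtain ⟨k, hlt, hk, hmod⟩ := Nat.forall_exists_prime_gt_and_eq_mod
          (q := 4) (a := 3) (by decide) (4 * D.natAbs)
        have hm : k % 4 = 3 := by
          have := (ZMod.natCast_eq_natCast_iff' k 3 4).mp (by exact_mod_cast hmod)
          omega
        have hc := hbig k hk hlt
        refine ⟨k, hc, ?_⟩
        rw [hDs, hs, jacobiSym.mul_left, hbk k hc, Nat.cast_one, mul_one,
          jacobiSym.at_neg_one (Nat.odd_iff.mpr (by omega)), ZMod.χ₄_nat_three_mod_four hm]
        norm_num
    · obtain ⟨k, hlt, hk, hmod⟩ := Nat.forall_exists_prime_gt_and_eq_mod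
          (q := 8) (a := 5) (by decide) (4 * D.natAbs)
      have hm : k % 8 = 5 := by
        have := (ZMod.natCast_eq_natCast_iff' k 5 8).mp (by exact_mod_cast hmod)
        omega
      have hc := hbig k hk hlt
      have hko : Odd k := Nat.odd_iff.mpr (by omega)
      have h2 : jacobiSym 2 k = -1 := by
        rw [jacobiSym.at_two hko, ZMod.χ₈_nat_eq_if_mod_eight]
        simp [hm]; omega
      have h1 : jacobiSym D.sign k = 1 := by
        rcases hs with hs | hs <;> rw [hs]
        · exact jacobiSym.one_left k
        · rw [jacobiSym.at_neg_one hko, ZMod.χ₄_nat_one_mod_four (by omega)]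
      refine ⟨k, hc, ?_⟩
      rw [hDs, jacobiSym.mul_left, hbk k hc, jacobiSym.mul_left]
      simp only [h1]
      push_cast
      rw [h2]; norm_num

theorem natCast_pow_cpow (p k : ℕ) (w : ℂ) : ((p ^ k : ℕ) : ℂ) ^ w = ((p : ℂ) ^ w) ^ k := by
  induction k with
  | zero => simp
  | succ k ih => rw [pow_succ, Nat.cast_mul, Complex.natCast_mul_natCast_cpow, ih, pow_succ]

theorem norm_prime_cpow_lt_one {p : ℕ} (hp : p.Prime) {w : ℂ} (hw : 1 < w.re) :
    ‖(p : ℂ) ^ (-w)‖ < 1 := by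
  rw [Complex.norm_natCast_cpow_of_pos hp.pos, Complex.neg_re]
  exact Real.rpow_lt_one_of_one_lt_of_neg (by exact_mod_cast hp.one_lt) (by linarith)

theorem summable_norm_mul_cpow {f : ℕ → ℤ} {K : ℕ} (hK : ∀ c, |f c| ≤ K) {w : ℂ}
    (hw : 1 < w.re) : Summable fun c : ℕ => ‖(f c : ℂ) * (c : ℂ) ^ (-w)‖ := by
  refine Summable.of_nonneg_of_le (fun _ => norm_nonneg _) (fun c => ?_)
    ((Real.summable_nat_rpow.mpr (show -w.re < -1 by linarith)).mul_left (K : ℝ))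
  rw [norm_mul, Complex.norm_natCast_cpow_of_re_ne_zero _ (by simp; linarith), Complex.neg_re,
    Complex.norm_intCast]
  gcongr
  exact_mod_cast hK c

theorem tsum_mul_riemannZeta {f : ArithmeticFunction ℤ} (hf : f.IsMultiplicative) {K : ℕ}
    (hK : ∀ c, |f c| ≤ K) {M : ℕ} [NeZero M] (χ : DirichletCharacter ℂ M)
    (hχ : ∀ p, p.Prime → ¬ p ∣ M → (f p : ℂ) = χ p ∧ f p ^ 2 = 1 ∧ ∀ k, f (p ^ (k + 2)) = 0)
    {w : ℂ} (hw : 1 < w.re) :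
    (∑' c : ℕ, (f c : ℂ) * (c : ℂ) ^ (-w)) * riemannZeta (2 * w) =
      χ.LFunction w * ∏ p ∈ M.primeFactors,
        ((∑' k, (f (p ^ k) : ℂ) * ((p : ℂ) ^ (-w)) ^ k) * (1 - ((p : ℂ) ^ (-w)) ^ 2)⁻¹) := by
  have h1 := EulerProduct.eulerProduct_hasProd (f := fun c : ℕ => (f c : ℂ) * (c : ℂ) ^ (-w))
    (by simp [hf.map_one])
    (by
      intro m n hmn
      simp only [hf.map_mul_of_coprime hmn, Nat.cast_mul, Complex.natCast_mul_natCast_cpow]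
      push_cast; ring)
    (summable_norm_mul_cpow hK hw) (by simp)
  have h2 := riemannZeta_eulerProduct_hasProd (s := 2 * w) (by simp; linarith)
  have h3 := χ.LSeries_eulerProduct_hasProd hw
  rw [← χ.LFunction_eq_LSeries hw] at h3
  set g : ℕ → ℂ := fun p =>
    (∑' k, (f (p ^ k) : ℂ) * ((p : ℂ) ^ (-w)) ^ k) * (1 - ((p : ℂ) ^ (-w)) ^ 2)⁻¹ with hg
  have h4 : HasProd (fun p : Nat.Primes => if (p : ℕ) ∈ M.primeFactors then g p else 1)
      (∏ p ∈ M.primeFactors, g p) := by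
    have := hasProd_prod_of_ne_finset_one (L := SummationFilter.unconditional _)
      (s := M.primeFactors.subtype Nat.Prime)
      (f := fun p : Nat.Primes => if (p : ℕ) ∈ M.primeFactors then g p else 1)
      (fun p hp => if_neg fun h => hp (Finset.mem_subtype.mpr h))
    convert this using 1
    exact (Finset.prod_congr rfl fun p hp => (if_pos hp).symm).trans
      (Finset.prod_subtype_of_mem (fun p => if p ∈ M.primeFactors then g p else 1)
        (fun p hp => Nat.prime_of_mem_primeFactors hp)).symm
  refine (h1.mul h2).unique ?_
  convert h3.mul h4 using 1
  funext p
  obtain ⟨p, hp⟩ := p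
  have hz : (p : ℂ) ^ (-(2 * w)) = ((p : ℂ) ^ (-w)) ^ 2 := by
    rw [← Complex.cpow_nat_mul]; congr 1; push_cast; ring
  simp only [natCast_pow_cpow, hz]
  by_cases hpM : p ∣ M
  · rw [if_pos (Nat.mem_primeFactors.mpr ⟨hp, hpM, NeZero.ne M⟩)]
    have h0 : χ (p : ZMod M) = 0 := by
      refine χ.map_nonunit fun hu => ?_
      rw [ZMod.isUnit_iff_coprime] at hu
      exact (Nat.Prime.coprime_iff_not_dvd hp).mp hu hpM
    rw [h0]; simp [hg]
  · rw [if_neg fun h => hpM (Nat.dvd_of_mem_primeFactors h), mul_one]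
    obtain ⟨e1, e2, e3⟩ := hχ p hp hpM
    set x := (p : ℂ) ^ (-w) with hx
    have hs : ∑' k, (f (p ^ k) : ℂ) * x ^ k = 1 + χ p * x := by
      rw [tsum_eq_sum (s := Finset.range 2), Finset.sum_range_succ, Finset.sum_range_one]
      · simp [hf.map_one, e1]
      · intro k hk
        obtain ⟨j, rfl⟩ : ∃ j, k = j + 2 := ⟨k - 2, by simp at hk; omega⟩
        rw [e3]; simp
    have hsq : χ (p : ZMod M) ^ 2 = 1 := by rw [← e1]; exact_mod_cast e2
    have hx1 : ‖x‖ < 1 := norm_prime_cpow_lt_one hp hw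
    have hnx : ‖χ (p : ZMod M) * x‖ < 1 := by
      rw [norm_mul]
      exact (mul_le_of_le_one_left (norm_nonneg _) (χ.norm_le_one _)).trans_lt hx1
    have hne1 : 1 + χ (p : ZMod M) * x ≠ 0 := fun h => by
      rw [← neg_eq_iff_add_eq_zero] at h
      rw [← h] at hnx; simp at hnx
    have hfac : 1 - x ^ 2 = (1 + χ (p : ZMod M) * x) * (1 - χ (p : ZMod M) * x) := by
      linear_combination x ^ 2 * hsq
    rw [hs, hfac, mul_inv, ← mul_assoc, mul_inv_cancel₀ hne1, one_mul]

theorem tendsto_tsum_prime_pow {f : ℕ → ℤ} {K : ℕ} (hK : ∀ c, |f c| ≤ K) {p : ℕ}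
    (hp : p.Prime) :
    Tendsto (fun w : ℝ => ∑' k, (f (p ^ k) : ℂ) * ((p : ℂ) ^ (-(w : ℂ))) ^ k) (𝓝[>] 1)
      (𝓝 (∑' k, (f (p ^ k) : ℂ) * ((p : ℂ)⁻¹) ^ k)) := by
  have hp0 : (p : ℂ) ≠ 0 := by exact_mod_cast hp.ne_zero
  refine tendsto_tsum_of_dominated_convergence (bound := fun k => (K : ℝ) * (1 / 2) ^ k)
    ((summable_geometric_two).mul_left _) (fun k => ?_) ?_
  · have hc : Continuous fun w : ℝ => (f (p ^ k) : ℂ) * ((p : ℂ) ^ (-(w : ℂ))) ^ k :=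
      continuous_const.mul ((Continuous.const_cpow (by fun_prop) (Or.inl hp0)).pow k)
    have := (hc.tendsto 1).mono_left (nhdsWithin_le_nhds (s := Set.Ioi (1 : ℝ)))
    simpa [Complex.cpow_neg_one] using this
  · filter_upwards [self_mem_nhdsWithin] with w hw k
    have hw : 1 < w := hw
    rw [norm_mul, norm_pow, Complex.norm_natCast_cpow_of_pos hp.pos, Complex.norm_intCast]
    have h2 : (p : ℝ) ^ (-(w : ℂ)).re ≤ 1 / 2 := by
      have hp2 : (2 : ℝ) ≤ p := by exact_mod_cast hp.two_le
      calc (p : ℝ) ^ (-(w : ℂ)).re ≤ (p : ℝ) ^ (-1 : ℝ) :=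
            Real.rpow_le_rpow_of_exponent_le (by linarith) (by simp; linarith)
        _ = (p : ℝ)⁻¹ := Real.rpow_neg_one _
        _ ≤ 1 / 2 := by rw [one_div]; gcongr
    gcongr
    exact_mod_cast hK _

theorem tendsto_sub_one_mul_tsum {f : ArithmeticFunction ℤ} (hf : f.IsMultiplicative) {K : ℕ}
    (hK : ∀ c, |f c| ≤ K) {M : ℕ} [NeZero M] (χ : DirichletCharacter ℂ M)
    (hχ : ∀ p, p.Prime → ¬ p ∣ M → (f p : ℂ) = χ p ∧ f p ^ 2 = 1 ∧ ∀ k, f (p ^ (k + 2)) = 0)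
    {ℓ : ℂ} (hℓ : Tendsto (fun s : ℂ => (s - 1) * χ.LFunction s) (𝓝[≠] 1) (𝓝 ℓ)) :
    Tendsto (fun w : ℝ => ((w : ℂ) - 1) * ∑' c : ℕ, (f c : ℂ) * (c : ℂ) ^ (-(w : ℂ))) (𝓝[>] 1)
      (𝓝 (ℓ * (∏ p ∈ M.primeFactors,
        ((∑' k, (f (p ^ k) : ℂ) * ((p : ℂ)⁻¹) ^ k) * (1 - ((p : ℂ)⁻¹) ^ 2)⁻¹)) *
          (6 / (π : ℂ) ^ 2))) := by
  have hcast : Tendsto (fun w : ℝ => (w : ℂ)) (𝓝[>] 1) (𝓝[≠] 1) := by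
    refine tendsto_nhdsWithin_iff.mpr ⟨?_, ?_⟩
    · have := (Complex.continuous_ofReal.tendsto 1).mono_left
        (nhdsWithin_le_nhds (s := Set.Ioi (1 : ℝ)))
      simpa using this
    · filter_upwards [self_mem_nhdsWithin] with w hw
      have hw : (1 : ℝ) < w := hw
      simp only [Set.mem_compl_iff, Set.mem_singleton_iff]
      exact_mod_cast hw.ne'
  have hL := hℓ.comp hcast
  have hP : Tendsto (fun w : ℝ => ∏ p ∈ M.primeFactors,
      ((∑' k, (f (p ^ k) : ℂ) * ((p : ℂ) ^ (-(w : ℂ))) ^ k) *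
        (1 - ((p : ℂ) ^ (-(w : ℂ))) ^ 2)⁻¹)) (𝓝[>] 1)
      (𝓝 (∏ p ∈ M.primeFactors,
        ((∑' k, (f (p ^ k) : ℂ) * ((p : ℂ)⁻¹) ^ k) * (1 - ((p : ℂ)⁻¹) ^ 2)⁻¹))) := by
    refine tendsto_finsetProd _ fun p hp => ?_
    have hpp := Nat.prime_of_mem_primeFactors hp
    have hp0 : (p : ℂ) ≠ 0 := by exact_mod_cast hpp.ne_zero
    refine (tendsto_tsum_prime_pow hK hpp).mul (Tendsto.inv₀ ?_ ?_)
    · have hc : Continuous fun w : ℝ => 1 - ((p : ℂ) ^ (-(w : ℂ))) ^ 2 :=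
        continuous_const.sub ((Continuous.const_cpow (by fun_prop) (Or.inl hp0)).pow 2)
      have := (hc.tendsto 1).mono_left (nhdsWithin_le_nhds (s := Set.Ioi (1 : ℝ)))
      simpa [Complex.cpow_neg_one] using this
    · have : ‖((p : ℂ)⁻¹) ^ 2‖ < 1 := by
        rw [norm_pow, norm_inv, Complex.norm_natCast]
        exact pow_lt_one₀ (by positivity)
          (inv_lt_one_of_one_lt₀ (by exact_mod_cast hpp.one_lt)) two_ne_zero
      intro h
      rw [← sub_eq_zero.mp h] at this
      simp at this
  have hZ : Tendsto (fun w : ℝ => (riemannZeta (2 * (w : ℂ)))⁻¹) (𝓝[>] 1)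
      (𝓝 (6 / (π : ℂ) ^ 2)) := by
    have h2 : Tendsto (fun w : ℝ => riemannZeta (2 * (w : ℂ))) (𝓝[>] 1) (𝓝 (riemannZeta 2)) := by
      have hd := (differentiableAt_riemannZeta (s := 2) (by norm_num)).continuousAt
      refine hd.tendsto.comp ?_
      have := ((hcast.mono_right nhdsWithin_le_nhds).const_mul (2 : ℂ))
      simpa using this
    have := h2.inv₀ (riemannZeta_ne_zero_of_one_lt_re (by norm_num))
    rwa [riemannZeta_two, inv_div] at this
  refine Tendsto.congr' ?_ ((hL.mul hP).mul hZ)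
  filter_upwards [self_mem_nhdsWithin] with w hw
  have hw : (1 : ℝ) < w := hw
  have hre : 1 < (w : ℂ).re := by simpa using hw
  have hz : riemannZeta (2 * (w : ℂ)) ≠ 0 :=
    riemannZeta_ne_zero_of_one_lt_re (by simp; linarith)
  have := tsum_mul_riemannZeta hf hK χ hχ hre
  rw [← eq_div_iff hz] at this
  rw [this]
  simp only [Function.comp_apply]
  ring

/-- The restriction of `rootMoebius n` to odd arguments. -/
def rootMoebiusOdd (n : ℤ) : ArithmeticFunction ℤ where
  toFun c := if Odd c then rootMoebius n c else 0
  map_zero' := by simp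

theorem rootMoebiusOdd_apply (n : ℤ) (c : ℕ) :
    rootMoebiusOdd n c = if Odd c then rootMoebius n c else 0 := rfl

theorem rootMoebiusOdd_isMultiplicative (n : ℤ) : (rootMoebiusOdd n).IsMultiplicative := by
  refine ⟨by simp [rootMoebiusOdd_apply, rootMoebius_one], fun {a b} hab => ?_⟩
  simp only [rootMoebiusOdd_apply, Nat.odd_mul,
    (rootMoebius_isMultiplicative n).map_mul_of_coprime hab]
  by_cases ha : Odd a <;> by_cases hb : Odd b <;> simp [ha, hb]

theorem rootMoebiusOdd_abs_le {n : ℤ} {K : ℕ} (hK : ∀ c, |rootMoebius n c| ≤ K) (c : ℕ) :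
    |rootMoebiusOdd n c| ≤ K := by
  rw [rootMoebiusOdd_apply]
  split_ifs
  · exact hK c
  · simp

theorem rootMoebius_prime_of_not_dvd {n : ℤ} {χ : DirichletCharacter ℂ (4 * (-n).natAbs)}
    (hχ : ∀ k : ℕ, k.Coprime (4 * (-n).natAbs) → χ k = (jacobiSym (-n) k : ℤ)) {p : ℕ}
    (hp : p.Prime) (hpM : ¬ p ∣ 4 * (-n).natAbs) :
    Odd p ∧ (rootMoebius n p : ℂ) = χ p ∧ rootMoebius n p ^ 2 = 1 ∧
      ∀ k, rootMoebius n (p ^ (k + 2)) = 0 := by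
  have hF : Fact p.Prime := ⟨hp⟩
  have hp2 : p ≠ 2 := by
    rintro rfl
    exact hpM (Dvd.intro (2 * (-n).natAbs) (by ring))
  have hpn : ¬ (p : ℤ) ∣ n := fun h => hpM (by
    rw [Int.natAbs_neg]
    exact (Int.natCast_dvd.mp h).mul_left 4)
  have hcop : p.Coprime (4 * (-n).natAbs) := (Nat.Prime.coprime_iff_not_dvd hp).mpr hpM
  refine ⟨hp.odd_of_ne_two hp2, ?_, ?_, rootMoebius_prime_pow_eq_zero hp hp2 hpn⟩
  · rw [rootMoebius_prime hp2, hχ p hcop]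
  · rw [rootMoebius_prime hp2]
    refine jacobiSym.sq_one ?_
    rw [Int.gcd_eq_natAbs_gcd_natAbs, Int.natAbs_natCast]
    exact (hcop.coprime_dvd_right (dvd_mul_left _ 4)).symm

theorem rootMoebiusOdd_prime_of_not_dvd {n : ℤ} {χ : DirichletCharacter ℂ (4 * (-n).natAbs)}
    (hχ : ∀ k : ℕ, k.Coprime (4 * (-n).natAbs) → χ k = (jacobiSym (-n) k : ℤ)) {p : ℕ}
    (hp : p.Prime) (hpM : ¬ p ∣ 4 * (-n).natAbs) :
    (rootMoebiusOdd n p : ℂ) = χ p ∧ rootMoebiusOdd n p ^ 2 = 1 ∧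
      ∀ k, rootMoebiusOdd n (p ^ (k + 2)) = 0 := by
  obtain ⟨h1, h2, h3, h4⟩ := rootMoebius_prime_of_not_dvd hχ hp hpM
  simp only [rootMoebiusOdd_apply, if_pos h1, if_pos h1.pow]
  exact ⟨h2, h3, h4⟩

/-- The Dirichlet series attached to an integer-valued arithmetic function, on the real line. -/
def intDirichletSeries (f : ℕ → ℤ) (w : ℝ) : ℂ := ∑' c : ℕ, (f c : ℂ) * (c : ℂ) ^ (-(w : ℂ))

theorem tendsto_rootMoebius_of_not_isSquare {n : ℤ} (hn : ¬ IsSquare (-n)) :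
    Tendsto (fun w : ℝ => ((w : ℂ) - 1) * intDirichletSeries (rootMoebius n) w) (𝓝[>] 1) (𝓝 0) ∧
    Tendsto (fun w : ℝ => ((w : ℂ) - 1) * intDirichletSeries (rootMoebiusOdd n) w)
      (𝓝[>] 1) (𝓝 0) := by
  have hn0 : -n ≠ 0 := by rintro h; exact hn (h ▸ IsSquare.zero)
  have hM : NeZero (4 * (-n).natAbs) := ⟨by simpa using hn0⟩
  obtain ⟨χ, hχ⟩ := exists_jacobi_character hn0
  obtain ⟨k, hk, hk1⟩ := exists_jacobiSym_eq_neg_one hn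
  obtain ⟨K, hK⟩ := rootMoebius_bounded (n := n) (by simpa using hn0)
  have hχ1 : χ ≠ 1 := by
    rintro rfl
    have h := hχ k hk
    rw [hk1, MulChar.one_apply ((ZMod.isUnit_iff_coprime _ _).mpr hk)] at h
    norm_num at h
  have hℓ : Tendsto (fun s : ℂ => (s - 1) * χ.LFunction s) (𝓝[≠] 1) (𝓝 0) := by
    have hc : Continuous fun s : ℂ => (s - 1) * χ.LFunction s :=
      (continuous_id.sub continuous_const).mul
        (DirichletCharacter.differentiable_LFunction hχ1).continuous
    have := (hc.tendsto 1).mono_left (nhdsWithin_le_nhds (s := {1}ᶜ))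
    simpa using this
  constructor
  · have := tendsto_sub_one_mul_tsum (rootMoebius_isMultiplicative n) hK χ
      (fun p hp hpM => (rootMoebius_prime_of_not_dvd hχ hp hpM).2) hℓ
    simpa only [zero_mul, intDirichletSeries] using this
  · have := tendsto_sub_one_mul_tsum (rootMoebiusOdd_isMultiplicative n)
      (rootMoebiusOdd_abs_le hK) χ
      (fun p hp hpM => rootMoebiusOdd_prime_of_not_dvd hχ hp hpM) hℓ
    simpa only [zero_mul, intDirichletSeries] using this

theorem tsum_rootMoebius_neg_sq {p : ℕ} (hp : p.Prime) {m : ℤ} (hm : m ≠ 0) :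
    ∑' k, (rootMoebius (-m ^ 2) (p ^ k) : ℂ) * ((p : ℂ)⁻¹) ^ k = 1 + (p : ℂ)⁻¹ := by
  have := Complex.hasSum_ofReal.mpr (hasSum_rootMoebius_prime_pow hp hm)
  push_cast at this
  exact this.tsum_eq

theorem prime_local_factor {p : ℕ} (hp : p.Prime) :
    (1 - (p : ℂ)⁻¹) * ((1 + (p : ℂ)⁻¹) * (1 - ((p : ℂ)⁻¹) ^ 2)⁻¹) = 1 := by
  have hn : ‖((p : ℂ)⁻¹) ^ 2‖ < 1 := by
    rw [norm_pow, norm_inv, Complex.norm_natCast]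
    exact pow_lt_one₀ (by positivity)
      (inv_lt_one_of_one_lt₀ (by exact_mod_cast hp.one_lt)) two_ne_zero
  have h : 1 - ((p : ℂ)⁻¹) ^ 2 ≠ 0 := fun h => by
    rw [← sub_eq_zero.mp h] at hn
    simp at hn
  rw [← mul_assoc, show (1 - (p : ℂ)⁻¹) * (1 + (p : ℂ)⁻¹) = 1 - ((p : ℂ)⁻¹) ^ 2 by ring,
    mul_inv_cancel₀ h]

theorem tsum_rootMoebiusOdd_neg_sq {p : ℕ} (hp : p.Prime) {m : ℤ} (hm : m ≠ 0) :
    ∑' k, (rootMoebiusOdd (-m ^ 2) (p ^ k) : ℂ) * ((p : ℂ)⁻¹) ^ k =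
      (1 + (p : ℂ)⁻¹) * if p = 2 then 2 / 3 else 1 := by
  by_cases h2 : p = 2
  · subst h2
    rw [tsum_eq_single 0]
    · rw [pow_zero, (rootMoebiusOdd_isMultiplicative _).map_one, if_pos rfl]; norm_num
    · intro k hk
      have : ¬ Odd (2 ^ k) := Nat.not_odd_iff_even.mpr ((Nat.even_pow.mpr ⟨even_two, hk⟩))
      rw [rootMoebiusOdd_apply, if_neg this]; simp
  · rw [if_neg h2, mul_one, ← tsum_rootMoebius_neg_sq hp hm]
    refine tsum_congr fun k => ?_
    rw [rootMoebiusOdd_apply, if_pos ((hp.odd_of_ne_two h2).pow)]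

theorem tendsto_rootMoebius_neg_sq {m : ℤ} (hm : m ≠ 0) :
    Tendsto (fun w : ℝ => ((w : ℂ) - 1) * intDirichletSeries (rootMoebius (-m ^ 2)) w) (𝓝[>] 1)
      (𝓝 (6 / (π : ℂ) ^ 2)) ∧
    Tendsto (fun w : ℝ => ((w : ℂ) - 1) * intDirichletSeries (rootMoebiusOdd (-m ^ 2)) w)
      (𝓝[>] 1) (𝓝 (4 / (π : ℂ) ^ 2)) := by
  have hn0 : -(-m ^ 2) ≠ 0 := by simpa using hm
  have hM : NeZero (4 * (-(-m ^ 2)).natAbs) := ⟨by simpa using hm⟩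
  obtain ⟨χ, hχ⟩ := exists_jacobi_character hn0
  obtain ⟨K, hK⟩ := rootMoebius_bounded (n := -m ^ 2) (by simpa using hm)
  have hJ : ∀ k : ℕ, k.Coprime (4 * (-(-m ^ 2)).natAbs) → jacobiSym (-(-m ^ 2)) k = 1 := by
    intro k hk
    rw [neg_neg, jacobiSym.sq_one']
    rw [Int.gcd_eq_natAbs_gcd_natAbs, Int.natAbs_natCast]
    refine (hk.coprime_dvd_right ?_).symm
    rw [neg_neg, Int.natAbs_pow]
    exact Dvd.intro_left (4 * m.natAbs) (by ring)
  have hχ1 : χ = 1 := by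
    refine MulChar.ext fun a => ?_
    have hu : IsUnit (((a : ZMod (4 * (-(-m ^ 2)).natAbs)).val : ℕ) :
        ZMod (4 * (-(-m ^ 2)).natAbs)) := by
      rw [ZMod.natCast_zmod_val]; exact a.isUnit
    have hk := (ZMod.isUnit_iff_coprime _ _).mp hu
    have h := hχ _ hk
    rw [hJ _ hk, ZMod.natCast_zmod_val] at h
    rw [h, MulChar.one_apply a.isUnit, Int.cast_one]
  subst hχ1
  have hℓ := DirichletCharacter.LFunctionTrivChar_residue_one (N := 4 * (-(-m ^ 2)).natAbs)
  constructor
  · have := tendsto_sub_one_mul_tsum (rootMoebius_isMultiplicative (-m ^ 2)) hK 1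
      (fun p hp hpM => (rootMoebius_prime_of_not_dvd hχ hp hpM).2) hℓ
    rw [← Finset.prod_mul_distrib, Finset.prod_eq_one, one_mul] at this
    · exact this
    · intro p hp
      have hpp := Nat.prime_of_mem_primeFactors hp
      rw [tsum_rootMoebius_neg_sq hpp hm, prime_local_factor hpp]
  · have := tendsto_sub_one_mul_tsum (rootMoebiusOdd_isMultiplicative (-m ^ 2))
      (rootMoebiusOdd_abs_le hK) 1
      (fun p hp hpM => rootMoebiusOdd_prime_of_not_dvd hχ hp hpM) hℓ
    rw [← Finset.prod_mul_distrib, Finset.prod_congr rfl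
      (g := fun p => if p = 2 then (2 / 3 : ℂ) else 1), Finset.prod_ite_eq', if_pos] at this
    · rwa [show (2 / 3 : ℂ) * (6 / (π : ℂ) ^ 2) = 4 / (π : ℂ) ^ 2 by ring] at this
    · refine Nat.mem_primeFactors.mpr ⟨Nat.prime_two, ?_, NeZero.ne _⟩
      exact Dvd.intro (2 * (-(-m ^ 2)).natAbs) (by ring)
    · intro p hp
      have hpp := Nat.prime_of_mem_primeFactors hp
      rw [tsum_rootMoebiusOdd_neg_sq hpp hm, mul_right_comm, ← mul_assoc, prime_local_factor hpp,
        one_mul]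

theorem sqrt_mul_rpow_eq_cpow {c : ℕ} (hc : 0 < c) (s : ℝ) :
    ((√(c : ℝ) : ℝ) : ℂ) * (((c : ℝ) ^ (-2 * s) : ℝ) : ℂ) =
      (c : ℂ) ^ (-((2 * s - 1 / 2 : ℝ) : ℂ)) := by
  have hc' : (0 : ℝ) < c := by exact_mod_cast hc
  rw [← Complex.ofReal_mul, Real.sqrt_eq_rpow, ← Real.rpow_add hc',
    show (1 / 2 + -2 * s : ℝ) = -(2 * s - 1 / 2) by ring, Complex.ofReal_cpow hc'.le]
  push_cast; rfl

theorem SKe_summand_eq (n : ℤ) (s : ℝ) (c : ℕ) :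
    (if Even c ∧ 0 < c then SKe n 0 c 3 * (((c : ℝ) ^ (-2 * s) : ℝ) : ℂ) else 0) =
      ee (-(1 : ℂ) / 8) * ((rootMoebius n (2 * c) : ℂ) *
        (c : ℂ) ^ (-((2 * s - 1 / 2 : ℝ) : ℂ))) := by
  rcases Nat.eq_zero_or_pos c with rfl | hc
  · simp
  · split_ifs with h
    · rw [SKe_eq n h.1 hc, ← sqrt_mul_rpow_eq_cpow hc]; ring
    · have ho : Odd c := Nat.not_even_iff_odd.mp fun he => h ⟨he, hc⟩
      rw [rootMoebius_two_mul_odd n ho]; simp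

theorem SKo_summand_eq (n : ℤ) (s : ℝ) (c : ℕ) :
    (if Odd c then SKo n 0 c 3 * (((c : ℝ) ^ (-2 * s) : ℝ) : ℂ) else 0) =
      ee ((3 : ℂ) / 8) * ((rootMoebiusOdd n c : ℂ) *
        (c : ℂ) ^ (-((2 * s - 1 / 2 : ℝ) : ℂ))) := by
  rw [rootMoebiusOdd_apply]
  split_ifs with h
  · rw [SKo_eq n h, ← sqrt_mul_rpow_eq_cpow h.pos]; ring
  · simp

theorem Zeven_eq (n : ℤ) (s : ℝ) : Zeven n s =
    ee (-(1 : ℂ) / 8) * intDirichletSeries (fun c => rootMoebius n (2 * c)) (2 * s - 1 / 2) := by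
  rw [Zeven, intDirichletSeries, ← tsum_mul_left]
  exact tsum_congr (SKe_summand_eq n s)

theorem Zodd_eq (n : ℤ) (s : ℝ) : Zodd n s =
    ee ((3 : ℂ) / 8) * intDirichletSeries (rootMoebiusOdd n) (2 * s - 1 / 2) := by
  rw [Zodd, intDirichletSeries, ← tsum_mul_left]
  exact tsum_congr (SKo_summand_eq n s)

theorem intDirichletSeries_rootMoebius_two_mul {n : ℤ} (hn : n ≠ 0) {w : ℝ} (hw : 1 < w) :
    intDirichletSeries (fun c => rootMoebius n (2 * c)) w = (2 : ℂ) ^ (w : ℂ) *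
      (intDirichletSeries (rootMoebius n) w - intDirichletSeries (rootMoebiusOdd n) w) := by
  obtain ⟨K, hK⟩ := rootMoebius_bounded hn
  have hre : 1 < (w : ℂ).re := by simpa using hw
  have hs1 := (summable_norm_mul_cpow hK hre).of_norm
  have hs2 := (summable_norm_mul_cpow (rootMoebiusOdd_abs_le hK) hre).of_norm
  have hs3 := (summable_norm_mul_cpow (f := fun c => rootMoebius n (2 * c))
    (fun c => hK (2 * c)) hre).of_norm
  have h2 : (2 : ℂ) ^ (w : ℂ) * (2 : ℂ) ^ (-(w : ℂ)) = 1 := by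
    rw [← Complex.cpow_add _ _ two_ne_zero, add_neg_cancel, Complex.cpow_zero]
  set F : ℕ → ℂ := fun c => (rootMoebius n c : ℂ) * (c : ℂ) ^ (-(w : ℂ)) -
    (rootMoebiusOdd n c : ℂ) * (c : ℂ) ^ (-(w : ℂ)) with hF
  have he : ∀ k, F (2 * k) = (2 : ℂ) ^ (-(w : ℂ)) *
      ((rootMoebius n (2 * k) : ℂ) * (k : ℂ) ^ (-(w : ℂ))) := by
    intro k
    have hodd : ¬ Odd (2 * k) := Nat.not_odd_iff_even.mpr (even_two_mul k)
    simp only [hF, rootMoebiusOdd_apply, if_neg hodd]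
    rw [Nat.cast_mul, Complex.natCast_mul_natCast_cpow]
    push_cast; ring
  have ho : ∀ k, F (2 * k + 1) = 0 := by
    intro k
    simp only [hF, rootMoebiusOdd_apply, if_pos (odd_two_mul_add_one k), sub_self]
  have hsum := tsum_even_add_odd (f := F) ((hs3.mul_left _).congr fun k => (he k).symm)
    (summable_zero.congr fun k => (ho k).symm)
  simp only [he, ho, tsum_zero, add_zero, tsum_mul_left] at hsum
  rw [intDirichletSeries, intDirichletSeries, intDirichletSeries, ← hs1.tsum_sub hs2, ← hsum,
    ← mul_assoc, h2, one_mul]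

theorem tendsto_two_mul_sub_half :
    Tendsto (fun s : ℝ => 2 * s - 1 / 2) (𝓝[>] (3 / 4)) (𝓝[>] 1) := by
  refine tendsto_nhdsWithin_iff.mpr ⟨?_, ?_⟩
  · have hc : Continuous fun s : ℝ => 2 * s - 1 / 2 := by fun_prop
    have := (hc.tendsto (3 / 4)).mono_left (nhdsWithin_le_nhds (s := Set.Ioi (3 / 4 : ℝ)))
    rwa [show (2 * (3 / 4) - 1 / 2 : ℝ) = 1 by norm_num] at this
  · filter_upwards [self_mem_nhdsWithin] with s hs
    have hs : 3 / 4 < s := hs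
    change 1 < 2 * s - 1 / 2
    linarith

theorem tendsto_Zodd {n : ℤ} {B : ℂ}
    (hB : Tendsto (fun w : ℝ => ((w : ℂ) - 1) * intDirichletSeries (rootMoebiusOdd n) w)
      (𝓝[>] 1) (𝓝 B)) :
    Tendsto (fun s : ℝ => ((s - 3 / 4 : ℝ) : ℂ) * Zodd n s) (𝓝[>] (3 / 4))
      (𝓝 (ee ((3 : ℂ) / 8) * (B / 2))) := by
  refine (((hB.comp tendsto_two_mul_sub_half).div_const 2).const_mul _).congr fun s => ?_
  rw [Zodd_eq, Function.comp_apply]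
  push_cast; ring

theorem tendsto_Zeven {n : ℤ} (hn : n ≠ 0) {A B : ℂ}
    (hA : Tendsto (fun w : ℝ => ((w : ℂ) - 1) * intDirichletSeries (rootMoebius n) w)
      (𝓝[>] 1) (𝓝 A))
    (hB : Tendsto (fun w : ℝ => ((w : ℂ) - 1) * intDirichletSeries (rootMoebiusOdd n) w)
      (𝓝[>] 1) (𝓝 B)) :
    Tendsto (fun s : ℝ => ((s - 3 / 4 : ℝ) : ℂ) * Zeven n s) (𝓝[>] (3 / 4))
      (𝓝 (ee (-(1 : ℂ) / 8) * (A - B))) := by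
  have h2 : Tendsto (fun w : ℝ => (2 : ℂ) ^ (w : ℂ)) (𝓝[>] 1) (𝓝 2) := by
    have hc : Continuous fun w : ℝ => (2 : ℂ) ^ (w : ℂ) :=
      Continuous.const_cpow (by fun_prop) (Or.inl two_ne_zero)
    have := (hc.tendsto 1).mono_left (nhdsWithin_le_nhds (s := Set.Ioi (1 : ℝ)))
    simpa using this
  have h := (((h2.mul (hA.sub hB)).comp tendsto_two_mul_sub_half).div_const 2).const_mul
    (ee (-(1 : ℂ) / 8))
  rw [mul_div_cancel_left₀ _ (two_ne_zero : (2 : ℂ) ≠ 0)] at h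
  refine h.congr' ?_
  filter_upwards [self_mem_nhdsWithin] with s hs
  have hs : 3 / 4 < s := hs
  rw [Zeven_eq, intDirichletSeries_rootMoebius_two_mul hn (by linarith), Function.comp_apply]
  push_cast; ring

theorem summable_norm_const_mul_cpow (z : ℂ) {f : ℕ → ℤ} {K : ℕ} (hK : ∀ c, |f c| ≤ K) {s : ℝ}
    (hs : 3 / 4 < s) :
    Summable fun c : ℕ => ‖z * ((f c : ℂ) * (c : ℂ) ^ (-((2 * s - 1 / 2 : ℝ) : ℂ)))‖ := by
  simp only [norm_mul z]
  exact (summable_norm_mul_cpow hK (by rw [Complex.ofReal_re]; linarith)).mul_left _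

/-- **Proposition 7.7 (residues at s = 3/4)**: for nonzero `n`, the series `Z_even(s)` and
`Z_odd(s)` converge absolutely for real `s > 3/4`; if `n = −m²` for a positive integer `m`,
then `(s−3/4)Z_even(s) → e(−1/8)·2/π²` and `(s−3/4)Z_odd(s) → e(3/8)·2/π²` as `s → 3/4⁺`,
while for every other nonzero `n` both limits are `0`. -/
theorem kloosterman_selberg_residues (n : ℤ) (hn : n ≠ 0) :
    (∀ s : ℝ, 3 / 4 < s →
      (Summable fun c : ℕ => ‖if Even c ∧ 0 < c then
          SKe n 0 c 3 * (((c : ℝ) ^ (-2 * s) : ℝ) : ℂ) else 0‖) ∧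
      (Summable fun c : ℕ => ‖if Odd c then
          SKo n 0 c 3 * (((c : ℝ) ^ (-2 * s) : ℝ) : ℂ) else 0‖)) ∧
    ((∃ m : ℕ, 0 < m ∧ n = -(m : ℤ) ^ 2) →
      Filter.Tendsto (fun s : ℝ => ((s - 3 / 4 : ℝ) : ℂ) * Zeven n s)
        (nhdsWithin (3 / 4) (Set.Ioi (3 / 4)))
        (nhds (ee (-(1 : ℂ) / 8) * ((2 / π ^ 2 : ℝ) : ℂ))) ∧
      Filter.Tendsto (fun s : ℝ => ((s - 3 / 4 : ℝ) : ℂ) * Zodd n s)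
        (nhdsWithin (3 / 4) (Set.Ioi (3 / 4)))
        (nhds (ee ((3 : ℂ) / 8) * ((2 / π ^ 2 : ℝ) : ℂ)))) ∧
    (¬(∃ m : ℕ, 0 < m ∧ n = -(m : ℤ) ^ 2) →
      Filter.Tendsto (fun s : ℝ => ((s - 3 / 4 : ℝ) : ℂ) * Zeven n s)
        (nhdsWithin (3 / 4) (Set.Ioi (3 / 4))) (nhds 0) ∧
      Filter.Tendsto (fun s : ℝ => ((s - 3 / 4 : ℝ) : ℂ) * Zodd n s)
        (nhdsWithin (3 / 4) (Set.Ioi (3 / 4))) (nhds 0)) := by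
  obtain ⟨K, hK⟩ := rootMoebius_bounded hn
  refine ⟨fun s hs => ⟨?_, ?_⟩, ?_, ?_⟩
  · simp only [SKe_summand_eq]
    exact summable_norm_const_mul_cpow _ (f := fun c => rootMoebius n (2 * c))
      (fun c => hK (2 * c)) hs
  · simp only [SKo_summand_eq]
    exact summable_norm_const_mul_cpow _ (rootMoebiusOdd_abs_le hK) hs
  · rintro ⟨m, hm, rfl⟩
    obtain ⟨hA, hB⟩ := tendsto_rootMoebius_neg_sq (m := m) (by exact_mod_cast hm.ne')
    have h1 := tendsto_Zeven hn hA hB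
    have h2 := tendsto_Zodd hB
    rw [show 6 / (π : ℂ) ^ 2 - 4 / (π : ℂ) ^ 2 = ((2 / π ^ 2 : ℝ) : ℂ) by push_cast; ring] at h1
    rw [show 4 / (π : ℂ) ^ 2 / 2 = ((2 / π ^ 2 : ℝ) : ℂ) by push_cast; ring] at h2
    exact ⟨h1, h2⟩
  · intro hsq
    have hns : ¬ IsSquare (-n) := by
      rintro ⟨r, hr⟩
      refine hsq ⟨r.natAbs, Int.natAbs_pos.mpr ?_, ?_⟩
      · rintro rfl
        exact hn (by simpa using hr)
      · rw [Int.natCast_natAbs, sq_abs, sq, ← hr, neg_neg]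
    obtain ⟨hA, hB⟩ := tendsto_rootMoebius_of_not_isSquare hns
    have h1 := tendsto_Zeven hn hA hB
    have h2 := tendsto_Zodd hB
    simp only [sub_zero, zero_div, mul_zero] at h1 h2
    exact ⟨h1, h2⟩

end
end

section
/- Lemma 9.2: For every τ in the upper half-plane ℍ, ((1+i)/(16π))·∫₀^{i∞} θ(u)·(τ+u)^{−3/2} du = (τ/(8i))^{1/2}·∫_ℝ e(ξ²τ)·[(1 + e(2ξτ))/(1 − e(2ξτ))]·ξ dξ, where ∫₀^{i∞} f(u) du := i·∫₀^∞ f(it) dt; the left-hand integrand is integrable on (0,∞), and the right-hand integrand (defined for ξ ≠ 0, with a removable singularity at ξ = 0 since 1 − e(2ξτ) ≠ 0 for real ξ ≠ 0) is Lebesgue integrable on ℝ. -/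
open Complex Real Filter Topology BigOperators MeasureTheory

noncomputable section

/-- Jacobi theta function `θ(u) = Σ_{n∈ℤ} e(n²u)` for `u` in the upper half-plane. -/
def theta (u : ℂ) : ℂ := ∑' n : ℤ, ee ((n : ℂ) ^ 2 * u)

lemma differentiableOn_integral_of_locally_dominated {α : Type*} [MeasurableSpace α]
    {μ : Measure α} {F : ℂ → α → ℂ} {U : Set ℂ} (hU : IsOpen U)
    (hmeas : ∀ z ∈ U, AEStronglyMeasurable (F z) μ)
    (hdiff : ∀ᵐ a ∂μ, DifferentiableOn ℂ (fun z => F z a) U)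
    (hbound : ∀ z ∈ U, ∃ V ∈ 𝓝 z, ∃ g : α → ℝ, Integrable g μ ∧
      ∀ᵐ a ∂μ, ∀ w ∈ V, ‖F w a‖ ≤ g a) :
    DifferentiableOn ℂ (fun z => ∫ a, F z a ∂μ) U := by
  intro z hz
  obtain ⟨V, hV, g, hg, hb⟩ := hbound z hz
  obtain ⟨ε, hε, hball⟩ := Metric.mem_nhds_iff.1 (Filter.inter_mem hV (hU.mem_nhds hz))
  have hsub : ∀ w ∈ Metric.ball z (ε / 2), Metric.closedBall w (ε / 3) ⊆ V ∩ U := by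
    intro w hw x hx
    apply hball
    rw [Metric.mem_ball] at hw ⊢
    rw [Metric.mem_closedBall] at hx
    linarith [dist_triangle x w z]
  refine (hasDerivAt_integral_of_dominated_loc_of_deriv_le
    (F' := fun w a => deriv (fun z => F z a) w) (bound := fun a => g a / (ε / 3))
    (Metric.ball_mem_nhds z (by positivity : 0 < ε / 2)) ?_ ?_ ?_ ?_ (hg.div_const _)
    ?_).2.differentiableAt.differentiableWithinAt
  · filter_upwards [hU.mem_nhds hz] with w hw using hmeas w hw
  · exact hg.mono' (hmeas z hz) (hb.mono fun a ha => ha z (mem_of_mem_nhds hV))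
  · have hu : Tendsto (fun n : ℕ => ((1 / ((n : ℝ) + 1) : ℝ) : ℂ)) atTop (𝓝[≠] 0) := by
      refine tendsto_nhdsWithin_iff.2 ⟨?_, Eventually.of_forall fun n => ?_⟩
      · exact_mod_cast (continuous_ofReal.tendsto 0).comp tendsto_one_div_add_atTop_nhds_zero_nat
      · have : (0 : ℝ) < 1 / ((n : ℝ) + 1) := by positivity
        exact ofReal_ne_zero.2 this.ne'
    have hzn : Tendsto (fun n : ℕ => z + ((1 / ((n : ℝ) + 1) : ℝ) : ℂ)) atTop (𝓝 z) := by
      simpa using (tendsto_nhds_of_tendsto_nhdsWithin hu).const_add z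
    obtain ⟨N, hN⟩ := eventually_atTop.1 (hzn.eventually (hU.mem_nhds hz))
    refine aestronglyMeasurable_of_tendsto_ae atTop
      (f := fun (n : ℕ) a => (((1 / (((n + N : ℕ) : ℝ) + 1) : ℝ) : ℂ))⁻¹ *
        (F (z + ((1 / (((n + N : ℕ) : ℝ) + 1) : ℝ) : ℂ)) a - F z a)) ?_ ?_
    · intro n
      exact ((hmeas _ (hN (n + N) (Nat.le_add_left _ _))).sub (hmeas z hz)).const_mul _
    · filter_upwards [hdiff] with a ha
      have := (ha.differentiableAt (hU.mem_nhds hz)).hasDerivAt.tendsto_slope_zero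
      exact (this.comp hu).comp (tendsto_add_atTop_nat N)
  · filter_upwards [hdiff, hb] with a ha hba w hw
    refine Complex.norm_deriv_le_of_forall_mem_sphere_norm_le (by positivity) ?_ ?_
    · refine (ha.mono ?_).diffContOnCl
      exact Metric.closure_ball_subset_closedBall.trans fun x hx => (hsub w hw hx).2
    · exact fun x hx => hba x (hsub w hw (Metric.sphere_subset_closedBall hx)).1
  · filter_upwards [hdiff] with a ha w hw
    exact (ha.differentiableAt (hU.mem_nhds
      (hsub w hw (Metric.mem_closedBall_self (by positivity))).2)).hasDerivAt

lemma hasSum_int_inv_sq_add_sq {x : ℝ} (hx : 0 < x) :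
    HasSum (fun n : ℤ => 1 / ((n : ℝ) ^ 2 + x ^ 2))
      (π / x * ((1 + rexp (-2 * π * x)) / (1 - rexp (-2 * π * x)))) := by
  have hxc : (x : ℂ) ≠ 0 := by exact_mod_cast hx.ne'
  have hz : I * x ∈ Complex.integerComplement := by
    rw [Complex.mem_integerComplement_iff]
    rintro ⟨n, hn⟩
    have := congrArg Complex.im hn
    simp at this
    exact hx.ne this
  have hq : (1 : ℂ) - cexp (-2 * π * x) ≠ 0 := by
    have : rexp (-2 * π * x) < 1 := by
      rw [Real.exp_lt_one_iff]
      nlinarith [mul_pos pi_pos hx]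
    have h2 : (1 : ℝ) - rexp (-2 * π * x) ≠ 0 := by linarith
    exact_mod_cast h2
  have h1 := (summable_cotTerm hz).hasSum
  simp only [cotTerm] at h1
  rw [← cot_series_rep' hz, Complex.cot_eq_exp_ratio,
    show 2 * I * (π * (I * x)) = -2 * π * x by linear_combination 2 * π * x * I_mul_I] at h1
  have h2 : HasSum (fun n : ℕ => 1 / (((n : ℝ) + 1) ^ 2 + x ^ 2))
      ((π * ((1 + rexp (-2 * π * x)) / (1 - rexp (-2 * π * x))) - 1 / x) / (2 * x)) := by
    rw [← Complex.hasSum_ofReal]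
    convert! h1.mul_left (I / (2 * x)) using 1
    · ext n
      have hb : I * x - ((n : ℂ) + 1) ≠ 0 := fun h => by
        have := congrArg Complex.im h
        simp at this
        exact hx.ne' this
      have hc : I * x + ((n : ℂ) + 1) ≠ 0 := fun h => by
        have := congrArg Complex.im h
        simp at this
        exact hx.ne' this
      have hd : ((n : ℂ) + 1) ^ 2 + (x : ℂ) ^ 2 ≠ 0 := by
        have : (0 : ℝ) < ((n : ℝ) + 1) ^ 2 + x ^ 2 := by positivity
        exact_mod_cast this.ne'
      have key : (I * x - ((n : ℂ) + 1)) * (I * x + ((n : ℂ) + 1)) =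
          -(((n : ℂ) + 1) ^ 2 + (x : ℂ) ^ 2) := by linear_combination (x : ℂ) ^ 2 * I_sq
      rw [div_add_div _ _ hb hc, key]
      push_cast
      field_simp
      linear_combination 2 * x * I_sq
    · push_cast
      field_simp
      ring_nf
  have h3 := HasSum.of_add_one_of_neg_add_one (f := fun n : ℤ => 1 / ((n : ℝ) ^ 2 + x ^ 2))
    (by simpa only [Int.cast_add, Int.cast_natCast, Int.cast_one] using h2)
    (by simpa only [Int.cast_neg, Int.cast_add, Int.cast_natCast, Int.cast_one, neg_sq] using h2)
  convert! h3 using 1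
  have hq' : 1 - rexp (-2 * π * x) ≠ 0 := by exact_mod_cast hq
  rw [Int.cast_zero]
  field_simp
  ring

lemma lintegral_Ioi_sq_mul_exp_neg_mul_sq {b : ℝ} (hb : 0 < b) :
    ∫⁻ x in Set.Ioi (0 : ℝ), ENNReal.ofReal (x ^ 2 * rexp (-b * x ^ 2)) =
      ENNReal.ofReal (√π / 4 * b ^ (-(3 : ℝ) / 2)) := by
  have h : ∀ x : ℝ, x ^ 2 * rexp (-b * x ^ 2) = x ^ (2 : ℝ) * rexp (-b * x ^ (2 : ℝ)) :=
    fun x => by rw [Real.rpow_two]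
  rw [← ofReal_integral_eq_lintegral_ofReal]
  · simp_rw [h]
    rw [integral_rpow_mul_exp_neg_mul_rpow two_pos (by norm_num) hb,
      show ((2 : ℝ) + 1) / 2 = 1 / 2 + 1 by norm_num, Real.Gamma_add_one (by norm_num),
      Real.Gamma_one_half_eq, show -((2 : ℝ) + 1) / 2 = -3 / 2 by norm_num]
    congr 1
    ring
  · simp_rw [h]
    exact integrableOn_rpow_mul_exp_neg_mul_rpow (by norm_num) two_pos hb
  · exact Eventually.of_forall fun x => by positivity

lemma lintegral_Ioi_exp_neg_mul {c : ℝ} (hc : 0 < c) :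
    ∫⁻ x in Set.Ioi (0 : ℝ), ENNReal.ofReal (rexp (-c * x)) = ENNReal.ofReal (1 / c) := by
  rw [← ofReal_integral_eq_lintegral_ofReal, integral_exp_mul_Ioi (by linarith)]
  · simp
  · exact integrableOn_exp_mul_Ioi (by linarith) 0
  · exact Eventually.of_forall fun x => by positivity

lemma summable_int_exp_neg_mul_sq {t : ℝ} (ht : 0 < t) :
    Summable fun n : ℤ => rexp (-π * t * (n : ℝ) ^ 2) := by
  refine (HurwitzKernelBounds.summable_f_int 0 0 ht).congr fun n => ?_
  simp only [HurwitzKernelBounds.f_int, add_zero, pow_zero, one_mul]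
  congr 1
  ring

lemma lintegral_theta_one_add_eq {y : ℝ} (hy : 0 < y) :
    ∫⁻ s in Set.Ioi (0 : ℝ), ENNReal.ofReal
        ((∑' n : ℤ, rexp (-π * (s / 2) * (n : ℝ) ^ 2)) *
          (√π / 4 * (2 * π * y * (1 + y * s)) ^ (-(3 : ℝ) / 2))) =
      ∫⁻ ξ in Set.Ioi (0 : ℝ), ENNReal.ofReal (1 / y * (rexp (-2 * π * y * ξ ^ 2) *
        ((1 + rexp (-4 * π * y * ξ)) / (1 - rexp (-4 * π * y * ξ))) * ξ)) := by
  let K : ℤ → ℝ → ℝ → ENNReal := fun n s ξ => ENNReal.ofReal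
    (rexp (-π * (s / 2) * (n : ℝ) ^ 2) * (ξ ^ 2 * rexp (-(2 * π * y * (1 + y * s)) * ξ ^ 2)))
  have hK : ∀ n, Measurable (Function.uncurry (K n)) := fun n => by
    simp only [K]
    fun_prop
  calc
    _ = ∫⁻ s in Set.Ioi (0 : ℝ), ∑' n : ℤ, ∫⁻ ξ in Set.Ioi (0 : ℝ), K n s ξ := by
      refine setLIntegral_congr_fun measurableSet_Ioi fun s hs => ?_
      have hs : 0 < s := hs
      have hb : 0 < 2 * π * y * (1 + y * s) := by positivity
      simp only [K]
      rw [← tsum_mul_right, ENNReal.ofReal_tsum_of_nonneg (fun n => by positivity)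
        ((summable_int_exp_neg_mul_sq (half_pos hs)).mul_right _)]
      refine tsum_congr fun n => ?_
      simp_rw [ENNReal.ofReal_mul (Real.exp_pos (-π * (s / 2) * (n : ℝ) ^ 2)).le]
      rw [lintegral_const_mul _ (by fun_prop), lintegral_Ioi_sq_mul_exp_neg_mul_sq hb]
    _ = ∑' n : ℤ, ∫⁻ s in Set.Ioi (0 : ℝ), ∫⁻ ξ in Set.Ioi (0 : ℝ), K n s ξ :=
      lintegral_tsum fun n => (hK n).lintegral_prod_right'.aemeasurable
    _ = ∑' n : ℤ, ∫⁻ ξ in Set.Ioi (0 : ℝ), ∫⁻ s in Set.Ioi (0 : ℝ), K n s ξ :=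
      tsum_congr fun n => lintegral_lintegral_swap (hK n).aemeasurable
    _ = ∫⁻ ξ in Set.Ioi (0 : ℝ), ∑' n : ℤ, ∫⁻ s in Set.Ioi (0 : ℝ), K n s ξ :=
      (lintegral_tsum fun n => (hK n).lintegral_prod_left'.aemeasurable).symm
    _ = _ := by
      refine setLIntegral_congr_fun measurableSet_Ioi fun ξ hξ => ?_
      have hξ : 0 < ξ := hξ
      have hsum := (hasSum_int_inv_sq_add_sq (x := 2 * y * ξ) (by positivity)).mul_left
        (ξ ^ 2 * rexp (-2 * π * y * ξ ^ 2) * (2 / π))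
      have hterm : ∀ n : ℤ, ∫⁻ s in Set.Ioi (0 : ℝ), K n s ξ = ENNReal.ofReal
          (ξ ^ 2 * rexp (-2 * π * y * ξ ^ 2) * (2 / π) *
            (1 / ((n : ℝ) ^ 2 + (2 * y * ξ) ^ 2))) := fun n => by
        have hc : 0 < π / 2 * ((n : ℝ) ^ 2 + (2 * y * ξ) ^ 2) := by positivity
        have : ∀ s, K n s ξ = ENNReal.ofReal (ξ ^ 2 * rexp (-2 * π * y * ξ ^ 2)) *
            ENNReal.ofReal (rexp (-(π / 2 * ((n : ℝ) ^ 2 + (2 * y * ξ) ^ 2)) * s)) := fun s => by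
          rw [← ENNReal.ofReal_mul (by positivity), mul_assoc, ← Real.exp_add]
          simp only [K]
          rw [mul_left_comm, ← Real.exp_add]
          ring_nf
        simp_rw [this]
        rw [lintegral_const_mul _ (by fun_prop), lintegral_Ioi_exp_neg_mul hc,
          ← ENNReal.ofReal_mul (by positivity)]
        congr 1
        field_simp
      simp_rw [hterm]
      rw [← ENNReal.ofReal_tsum_of_nonneg (fun n => by positivity) hsum.summable, hsum.tsum_eq,
        show -2 * π * (2 * y * ξ) = -4 * π * y * ξ by ring]
      congr 1
      field_simp

lemma lintegral_theta_add_eq {y : ℝ} (hy : 0 < y) :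
    ∫⁻ t in Set.Ioi (0 : ℝ), ENNReal.ofReal
        ((∑' n : ℤ, rexp (-π * (2 * t) * (n : ℝ) ^ 2)) * (y + t) ^ (-(3 : ℝ) / 2)) =
      ENNReal.ofReal (8 * π * √y) * ∫⁻ ξ in Set.Ioi (0 : ℝ), ENNReal.ofReal
        (rexp (-2 * π * y * ξ ^ 2) *
          ((1 + rexp (-4 * π * y * ξ)) / (1 - rexp (-4 * π * y * ξ))) * ξ) := by
  have himg : (fun s : ℝ => s⁻¹) '' Set.Ioi 0 = Set.Ioi 0 := by
    ext x
    simp only [Set.mem_image, Set.mem_Ioi]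
    exact ⟨fun ⟨s, hs, h⟩ => h ▸ inv_pos.2 hs, fun hx => ⟨x⁻¹, inv_pos.2 hx, inv_inv x⟩⟩
  have hcov := lintegral_image_eq_lintegral_abs_deriv_mul (s := Set.Ioi (0 : ℝ))
    (f := fun s => s⁻¹) (f' := fun s => -(s ^ 2)⁻¹) measurableSet_Ioi
    (fun s hs => (hasDerivAt_inv (ne_of_gt hs)).hasDerivWithinAt) inv_injective.injOn
    (fun t => ENNReal.ofReal
      ((∑' n : ℤ, rexp (-π * (2 * t) * (n : ℝ) ^ 2)) * (y + t) ^ (-(3 : ℝ) / 2)))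
  rw [himg] at hcov
  rw [hcov]
  have hcongr : ∀ s ∈ Set.Ioi (0 : ℝ), ENNReal.ofReal |-(s ^ 2)⁻¹| * ENNReal.ofReal
        ((∑' n : ℤ, rexp (-π * (2 * s⁻¹) * (n : ℝ) ^ 2)) * (y + s⁻¹) ^ (-(3 : ℝ) / 2)) =
      ENNReal.ofReal (8 * π * √y * y) * ENNReal.ofReal
        ((∑' n : ℤ, rexp (-π * (s / 2) * (n : ℝ) ^ 2)) *
          (√π / 4 * (2 * π * y * (1 + y * s)) ^ (-(3 : ℝ) / 2))) := by
    intro s hs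
    have hs : 0 < s := hs
    rw [← ENNReal.ofReal_mul (abs_nonneg _), ← ENNReal.ofReal_mul (by positivity)]
    congr 1
    rw [Real.tsum_exp_neg_mul_int_sq (by positivity : 0 < 2 * s⁻¹),
      show -π / (2 * s⁻¹) = -π * (s / 2) by field_simp, abs_neg,
      abs_of_pos (by positivity : 0 < (s ^ 2)⁻¹),
      show y + s⁻¹ = (1 + y * s) / s by field_simp; ring]
    have h32 : ∀ x : ℝ, 0 < x → x ^ (-(3 : ℝ) / 2) = (x * √x)⁻¹ := fun x hx => by
      rw [neg_div, Real.rpow_neg hx.le, show (3 : ℝ) / 2 = 1 + 1 / 2 by norm_num,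
        Real.rpow_add hx, Real.rpow_one, Real.sqrt_eq_rpow]
    have hw : 0 < 1 + y * s := by positivity
    rw [h32 _ (by positivity), h32 _ (by positivity), ← Real.sqrt_eq_rpow,
      Real.sqrt_mul (by positivity), Real.sqrt_mul (by positivity), Real.sqrt_mul (by positivity),
      Real.sqrt_mul (by positivity), Real.sqrt_div (by positivity), Real.sqrt_inv]
    have h1 := Real.sq_sqrt hs.le
    have h1' := Real.sqrt_pos.2 hs
    have h2' := Real.sqrt_pos.2 (two_pos (α := ℝ))
    have h3' := Real.sqrt_pos.2 hy
    have h4' := Real.sqrt_pos.2 hw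
    have h5' := Real.sqrt_pos.2 pi_pos
    field_simp
    simp only [h1]
    ring
  rw [setLIntegral_congr_fun measurableSet_Ioi hcongr, lintegral_const_mul',
    lintegral_theta_one_add_eq hy]
  · simp_rw [ENNReal.ofReal_mul (one_div_pos.2 hy).le]
    rw [lintegral_const_mul _ (by fun_prop), ← mul_assoc, ← ENNReal.ofReal_mul (by positivity)]
    congr 2
    field_simp
  · exact ENNReal.ofReal_ne_top

/-- The integrand `e(ξ²τ) (1 + e(2ξτ)) / (1 - e(2ξτ)) ξ`. -/
def cotKernel (τ : ℂ) (ξ : ℝ) : ℂ :=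
  ee ((ξ : ℂ) ^ 2 * τ) * ((1 + ee (2 * (ξ : ℂ) * τ)) / (1 - ee (2 * (ξ : ℂ) * τ))) * (ξ : ℂ)

/-- The integrand `θ(it) (τ + it)^(-3/2)`. -/
def thetaKernel (τ : ℂ) (t : ℝ) : ℂ :=
  theta (Complex.I * t) * (τ + Complex.I * t) ^ (-(3 : ℂ) / 2)

lemma norm_ee (x : ℂ) : ‖ee x‖ = rexp (-2 * π * x.im) := by
  simp [ee, Complex.norm_exp]

lemma one_sub_ee_ne_zero {τ : ℂ} (hτ : 0 < τ.im) {ξ : ℝ} (hξ : ξ ≠ 0) :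
    1 - ee (2 * (ξ : ℂ) * τ) ≠ 0 := by
  intro h
  have h1 : ‖ee (2 * (ξ : ℂ) * τ)‖ = 1 := by rw [← sub_eq_zero.1 h, norm_one]
  rw [norm_ee, Real.exp_eq_one_iff] at h1
  have : (2 * (ξ : ℂ) * τ).im = 2 * ξ * τ.im := by simp
  rw [this] at h1
  have : -2 * π * (2 * ξ * τ.im) ≠ 0 := by
    have := pi_ne_zero
    have := hτ.ne'
    positivity
  exact this h1

lemma cotKernel_neg (τ : ℂ) (ξ : ℝ) : cotKernel τ (-ξ) = cotKernel τ ξ := by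
  have h : ee (2 * ((-ξ : ℝ) : ℂ) * τ) = (ee (2 * (ξ : ℂ) * τ))⁻¹ := by
    rw [ee, ee, ← Complex.exp_neg]
    congr 1
    push_cast
    ring
  have h0 : ee (2 * (ξ : ℂ) * τ) ≠ 0 := Complex.exp_ne_zero _
  unfold cotKernel
  rw [h]
  set q := ee (2 * (ξ : ℂ) * τ)
  have h2 : (1 + q⁻¹) / (1 - q⁻¹) = -((1 + q) / (1 - q)) := by
    rw [← mul_div_mul_left (1 + q⁻¹) (1 - q⁻¹) h0, ← div_neg]
    congr 1
    · field_simp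
      ring
    · field_simp
      ring
  rw [h2]
  push_cast
  ring_nf

lemma cotKernel_abs (τ : ℂ) (ξ : ℝ) : cotKernel τ |ξ| = cotKernel τ ξ := by
  rcases abs_choice ξ with h | h <;> rw [h]
  exact cotKernel_neg τ ξ

lemma norm_cotKernel_le {y : ℝ} (hy : 0 < y) {τ : ℂ} (hτ : y ≤ τ.im) (ξ : ℝ) :
    ‖cotKernel τ ξ‖ ≤ rexp (-(2 * π * y) * ξ ^ 2) * (2 * |ξ| + 1 / (2 * π * y)) := by
  wlog hξ : 0 < ξ generalizing ξ
  · rcases (not_lt.1 hξ).lt_or_eq with h | h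
    · simpa [cotKernel_neg] using this (-ξ) (by linarith)
    · subst h
      simp only [cotKernel, ofReal_zero, mul_zero, norm_zero]
      positivity
  rw [abs_of_pos hξ]
  have hqn : ‖ee (2 * (ξ : ℂ) * τ)‖ ≤ rexp (-(4 * π * y * ξ)) := by
    rw [norm_ee, Real.exp_le_exp]
    have : (2 * (ξ : ℂ) * τ).im = 2 * ξ * τ.im := by simp
    rw [this]
    nlinarith [mul_le_mul_of_nonneg_left hτ (by positivity : 0 ≤ 4 * π * ξ)]
  have hen : ‖ee ((ξ : ℂ) ^ 2 * τ)‖ ≤ rexp (-(2 * π * y) * ξ ^ 2) := by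
    rw [norm_ee, Real.exp_le_exp]
    have : ((ξ : ℂ) ^ 2 * τ).im = ξ ^ 2 * τ.im := by
      rw [← ofReal_pow, im_ofReal_mul]
    rw [this]
    nlinarith [mul_le_mul_of_nonneg_left hτ (by positivity : 0 ≤ 2 * π * ξ ^ 2)]
  have hc : 0 < 4 * π * y * ξ := by positivity
  have hexp : rexp (-(4 * π * y * ξ)) ≤ 1 / (1 + 4 * π * y * ξ) := by
    rw [Real.exp_neg, ← one_div]
    exact one_div_le_one_div_of_le (by positivity)
      (by linarith [Real.add_one_le_exp (4 * π * y * ξ)])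
  set q := ee (2 * (ξ : ℂ) * τ)
  have hnum : ‖1 + q‖ ≤ 2 := by
    refine (norm_add_le _ _).trans ?_
    have : rexp (-(4 * π * y * ξ)) ≤ 1 := Real.exp_le_one_iff.2 (by linarith)
    rw [norm_one]
    linarith
  have hden : 4 * π * y * ξ / (1 + 4 * π * y * ξ) ≤ ‖1 - q‖ := by
    have h1 := norm_sub_norm_le 1 q
    rw [norm_one] at h1
    have h2 : 4 * π * y * ξ / (1 + 4 * π * y * ξ) = 1 - 1 / (1 + 4 * π * y * ξ) := by
      field_simp
      ring
    linarith
  unfold cotKernel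
  rw [norm_mul, norm_mul, norm_div, mul_assoc, norm_real, Real.norm_of_nonneg hξ.le]
  refine mul_le_mul hen ?_ (by positivity) (by positivity)
  calc
    _ ≤ 2 / (4 * π * y * ξ / (1 + 4 * π * y * ξ)) * ξ := by gcongr
    _ = _ := by
      field_simp
      ring

lemma integrable_exp_neg_mul_sq_mul_abs_add {b : ℝ} (hb : 0 < b) (c : ℝ) :
    Integrable fun ξ : ℝ => rexp (-b * ξ ^ 2) * (2 * |ξ| + c) := by
  have h1 := (integrable_mul_exp_neg_mul_sq hb).norm.const_mul 2
  have h2 := (integrable_exp_neg_mul_sq hb).mul_const c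
  refine (h1.add h2).congr (Eventually.of_forall fun ξ => ?_)
  simp only [Pi.add_apply, norm_mul, Real.norm_eq_abs, Real.abs_exp]
  ring

lemma measurable_cotKernel (τ : ℂ) : Measurable (cotKernel τ) := by
  unfold cotKernel ee
  fun_prop

lemma integrable_cotKernel {τ : ℂ} (hτ : 0 < τ.im) : Integrable (cotKernel τ) :=
  (integrable_exp_neg_mul_sq_mul_abs_add (b := 2 * π * τ.im) (by positivity) _).mono'
    (measurable_cotKernel τ).aestronglyMeasurable
    (Eventually.of_forall fun ξ => norm_cotKernel_le hτ le_rfl ξ)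

lemma setOf_half_im_lt_mem_nhds {τ : ℂ} (hτ : 0 < τ.im) : {w : ℂ | τ.im / 2 < w.im} ∈ 𝓝 τ :=
  (isOpen_lt continuous_const continuous_im).mem_nhds (half_lt_self hτ)

lemma differentiableOn_integral_cotKernel :
    DifferentiableOn ℂ (fun τ => ∫ ξ, cotKernel τ ξ) {τ | 0 < τ.im} := by
  refine differentiableOn_integral_of_locally_dominated
    (isOpen_lt continuous_const continuous_im)
    (fun τ _ => (measurable_cotKernel τ).aestronglyMeasurable)
    (Eventually.of_forall fun ξ τ hτ => ?_) (fun τ hτ => ?_)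
  · by_cases hξ : ξ = 0
    · simp only [cotKernel, hξ, ofReal_zero, mul_zero]
      exact differentiableWithinAt_const 0
    · have := one_sub_ee_ne_zero hτ hξ
      unfold cotKernel
      unfold ee at *
      fun_prop (disch := assumption)
  · have hτ : 0 < τ.im := hτ
    exact ⟨_, setOf_half_im_lt_mem_nhds hτ, _,
      integrable_exp_neg_mul_sq_mul_abs_add (b := 2 * π * (τ.im / 2)) (by positivity) _,
      Eventually.of_forall fun ξ w hw => norm_cotKernel_le (half_pos hτ) (le_of_lt hw) ξ⟩

lemma theta_I_mul (t : ℝ) :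
    theta (Complex.I * t) = ((∑' n : ℤ, rexp (-π * (2 * t) * (n : ℝ) ^ 2) : ℝ) : ℂ) := by
  rw [theta, ofReal_tsum]
  refine tsum_congr fun n => ?_
  rw [ee, ofReal_exp]
  congr 1
  push_cast
  linear_combination 2 * (π : ℂ) * n ^ 2 * t * I_sq

lemma cotKernel_I_mul (y ξ : ℝ) :
    cotKernel (Complex.I * y) ξ = ((rexp (-2 * π * y * ξ ^ 2) *
      ((1 + rexp (-4 * π * y * ξ)) / (1 - rexp (-4 * π * y * ξ))) * ξ : ℝ) : ℂ) := by
  have h1 : 2 * (π : ℂ) * I * (2 * ξ * (I * y)) = -4 * π * y * ξ := by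
    linear_combination 4 * (π : ℂ) * ξ * y * I_sq
  have h2 : 2 * (π : ℂ) * I * (ξ ^ 2 * (I * y)) = -2 * π * y * ξ ^ 2 := by
    linear_combination 2 * (π : ℂ) * ξ ^ 2 * y * I_sq
  simp only [cotKernel, ee, h1, h2]
  push_cast
  rfl

lemma exp_mul_coth_mul_nonneg {y ξ : ℝ} (hy : 0 < y) (hξ : 0 < ξ) :
    0 ≤ rexp (-2 * π * y * ξ ^ 2) *
      ((1 + rexp (-4 * π * y * ξ)) / (1 - rexp (-4 * π * y * ξ))) * ξ := by
  have : rexp (-4 * π * y * ξ) ≤ 1 := Real.exp_le_one_iff.2 (by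
    have : 0 < 4 * π * y * ξ := by positivity
    linarith)
  have : 0 ≤ 1 - rexp (-4 * π * y * ξ) := by linarith
  positivity

lemma integrable_exp_mul_coth_mul {y : ℝ} (hy : 0 < y) :
    Integrable fun ξ : ℝ => rexp (-2 * π * y * ξ ^ 2) *
      ((1 + rexp (-4 * π * y * ξ)) / (1 - rexp (-4 * π * y * ξ))) * ξ := by
  have := (integrable_cotKernel (τ := Complex.I * y) (by simpa using hy)).re
  refine this.congr (Eventually.of_forall fun ξ => ?_)
  beta_reduce
  rw [cotKernel_I_mul]
  exact ofReal_re _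

lemma measurable_theta_mul_rpow (y : ℝ) : Measurable fun t : ℝ =>
    (∑' n : ℤ, rexp (-π * (2 * t) * (n : ℝ) ^ 2)) * (y + t) ^ (-(3 : ℝ) / 2) := by
  have : Measurable fun t : ℝ => ∑' n : ℤ, rexp (-π * (2 * t) * (n : ℝ) ^ 2) :=
    Measurable.tsum fun n => by fun_prop
  fun_prop

lemma theta_mul_rpow_nonneg {y t : ℝ} (hy : 0 < y) (ht : 0 < t) :
    0 ≤ (∑' n : ℤ, rexp (-π * (2 * t) * (n : ℝ) ^ 2)) * (y + t) ^ (-(3 : ℝ) / 2) :=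
  mul_nonneg (tsum_nonneg fun n => (Real.exp_pos _).le) (by positivity)

lemma integrableOn_theta_mul_rpow {y : ℝ} (hy : 0 < y) : IntegrableOn (fun t : ℝ =>
    (∑' n : ℤ, rexp (-π * (2 * t) * (n : ℝ) ^ 2)) * (y + t) ^ (-(3 : ℝ) / 2)) (Set.Ioi 0) := by
  refine ⟨(measurable_theta_mul_rpow y).aestronglyMeasurable, ?_⟩
  rw [hasFiniteIntegral_iff_ofReal ((ae_restrict_iff' measurableSet_Ioi).2
    (Eventually.of_forall fun t ht => theta_mul_rpow_nonneg hy ht)), lintegral_theta_add_eq hy]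
  refine ENNReal.mul_lt_top ENNReal.ofReal_lt_top ?_
  exact (hasFiniteIntegral_iff_ofReal ((ae_restrict_iff' measurableSet_Ioi).2
    (Eventually.of_forall fun ξ hξ => exp_mul_coth_mul_nonneg hy hξ))).1
    (integrable_exp_mul_coth_mul hy).integrableOn.2

lemma integral_theta_mul_rpow {y : ℝ} (hy : 0 < y) :
    ∫ t in Set.Ioi (0 : ℝ),
        (∑' n : ℤ, rexp (-π * (2 * t) * (n : ℝ) ^ 2)) * (y + t) ^ (-(3 : ℝ) / 2) =
      4 * π * √y * ∫ ξ : ℝ, rexp (-2 * π * y * ξ ^ 2) *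
        ((1 + rexp (-4 * π * y * ξ)) / (1 - rexp (-4 * π * y * ξ))) * ξ := by
  have heven : ∫ ξ : ℝ, rexp (-2 * π * y * ξ ^ 2) *
        ((1 + rexp (-4 * π * y * ξ)) / (1 - rexp (-4 * π * y * ξ))) * ξ =
      2 * ∫ ξ in Set.Ioi (0 : ℝ), rexp (-2 * π * y * ξ ^ 2) *
        ((1 + rexp (-4 * π * y * ξ)) / (1 - rexp (-4 * π * y * ξ))) * ξ := by
    rw [← integral_comp_abs]
    congr 1
    ext ξ
    have := cotKernel_abs (Complex.I * y) ξ
    rw [cotKernel_I_mul, cotKernel_I_mul] at this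
    exact (ofReal_injective this).symm
  rw [heven, integral_eq_lintegral_of_nonneg_ae, integral_eq_lintegral_of_nonneg_ae,
    lintegral_theta_add_eq hy, ENNReal.toReal_mul, ENNReal.toReal_ofReal (by positivity)]
  · ring
  · exact (ae_restrict_iff' measurableSet_Ioi).2
      (Eventually.of_forall fun ξ hξ => exp_mul_coth_mul_nonneg hy hξ)
  · exact (integrable_exp_mul_coth_mul hy).integrableOn.1
  · exact (ae_restrict_iff' measurableSet_Ioi).2
      (Eventually.of_forall fun t ht => theta_mul_rpow_nonneg hy ht)
  · exact (measurable_theta_mul_rpow y).aestronglyMeasurable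

lemma norm_thetaKernel_le {y : ℝ} (hy : 0 < y) {τ : ℂ} (hτ : y ≤ τ.im) {t : ℝ} (ht : 0 < t) :
    ‖thetaKernel τ t‖ ≤
      (∑' n : ℤ, rexp (-π * (2 * t) * (n : ℝ) ^ 2)) * (y + t) ^ (-(3 : ℝ) / 2) := by
  have h32 : (-(3 : ℂ) / 2) = ((-(3 : ℝ) / 2 : ℝ) : ℂ) := by push_cast; rfl
  rw [thetaKernel, theta_I_mul, norm_mul, norm_real, h32, norm_cpow_real,
    Real.norm_of_nonneg (tsum_nonneg fun n => (Real.exp_pos _).le)]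
  refine mul_le_mul_of_nonneg_left ?_ (tsum_nonneg fun n => (Real.exp_pos _).le)
  refine Real.rpow_le_rpow_of_nonpos (by positivity) ?_ (by norm_num)
  calc
    y + t ≤ (τ + I * t).im := by simpa using hτ
    _ ≤ _ := im_le_norm _

lemma measurable_thetaKernel (τ : ℂ) : Measurable (thetaKernel τ) := by
  have : Measurable fun t : ℝ => theta (Complex.I * t) :=
    Measurable.tsum fun n => by unfold ee; fun_prop
  unfold thetaKernel
  fun_prop

lemma integrableOn_thetaKernel {τ : ℂ} (hτ : 0 < τ.im) :
    IntegrableOn (thetaKernel τ) (Set.Ioi 0) :=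
  (integrableOn_theta_mul_rpow hτ).mono' (measurable_thetaKernel τ).aestronglyMeasurable
    ((ae_restrict_iff' measurableSet_Ioi).2
      (Eventually.of_forall fun _ ht => norm_thetaKernel_le hτ le_rfl ht))

lemma differentiableOn_integral_thetaKernel :
    DifferentiableOn ℂ (fun τ => ∫ t in Set.Ioi (0 : ℝ), thetaKernel τ t) {τ | 0 < τ.im} := by
  refine differentiableOn_integral_of_locally_dominated
    (isOpen_lt continuous_const continuous_im)
    (fun τ _ => (measurable_thetaKernel τ).aestronglyMeasurable)
    ((ae_restrict_iff' measurableSet_Ioi).2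
      (Eventually.of_forall fun t ht τ hτ => ?_)) (fun τ hτ => ?_)
  · have hs : τ + I * t ∈ slitPlane := by
      refine Or.inr (ne_of_gt ?_)
      have h1 : 0 < τ.im := hτ
      have h2 : 0 < t := ht
      simpa using add_pos h1 h2
    unfold thetaKernel
    exact (((differentiableAt_id.add_const _).cpow_const hs).const_mul
      _).differentiableWithinAt
  · have hτ : 0 < τ.im := hτ
    exact ⟨_, setOf_half_im_lt_mem_nhds hτ, _, integrableOn_theta_mul_rpow (half_pos hτ),
      (ae_restrict_iff' measurableSet_Ioi).2 (Eventually.of_forall fun t ht w hw =>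
        norm_thetaKernel_le (half_pos hτ) (le_of_lt hw) ht)⟩

lemma one_add_I_mul_I_mul_I_cpow : (1 + I) * (I * I ^ (-(3 : ℂ) / 2)) = (√2 : ℝ) := by
  have h : I ^ (-(3 : ℂ) / 2) = -((√2 / 2 : ℝ) : ℂ) - ((√2 / 2 : ℝ) : ℂ) * I := by
    rw [cpow_def_of_ne_zero I_ne_zero, log_I,
      show (π : ℂ) / 2 * I * (-3 / 2) = ((π / 4 - π : ℝ) : ℂ) * I by push_cast; ring,
      exp_mul_I, ← ofReal_cos, ← ofReal_sin, Real.cos_sub_pi, Real.sin_sub_pi,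
      Real.cos_pi_div_four, Real.sin_pi_div_four]
    push_cast
    ring
  rw [h]
  push_cast
  linear_combination (-(√2 : ℂ) - (√2 : ℂ) / 2 * I) * I_sq

lemma integral_thetaKernel_I_mul {y : ℝ} (hy : 0 < y) :
    ((1 + I) / (16 * (π : ℂ))) *
        (I * ∫ t in Set.Ioi (0 : ℝ), thetaKernel (I * y) t) =
      (I * y / (8 * I)) ^ ((1 : ℂ) / 2) * ∫ ξ : ℝ, cotKernel (I * y) ξ := by
  have hG : ∫ t in Set.Ioi (0 : ℝ), thetaKernel (I * y) t = I ^ (-(3 : ℂ) / 2) *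
      ((∫ t in Set.Ioi (0 : ℝ), (∑' n : ℤ, rexp (-π * (2 * t) * (n : ℝ) ^ 2)) *
        (y + t) ^ (-(3 : ℝ) / 2) : ℝ) : ℂ) := by
    rw [← integral_complex_ofReal, ← integral_const_mul]
    refine setIntegral_congr_fun measurableSet_Ioi fun t ht => ?_
    have hyt : 0 < y + t := add_pos hy ht
    simp only [thetaKernel]
    rw [theta_I_mul, show I * (y : ℂ) + I * t = ((y + t : ℝ) : ℂ) * I by push_cast; ring,
      cpow_def_of_ne_zero (mul_ne_zero (ofReal_ne_zero.2 hyt.ne') I_ne_zero),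
      log_ofReal_mul hyt I_ne_zero, add_mul, Complex.exp_add, cpow_def_of_ne_zero I_ne_zero,
      Real.rpow_def_of_pos hyt]
    push_cast
    ring
  have hsqrt : (I * y / (8 * I)) ^ ((1 : ℂ) / 2) = ((√y / (2 * √2) : ℝ) : ℂ) := by
    rw [show I * (y : ℂ) / (8 * I) = ((y / 8 : ℝ) : ℂ) by
        push_cast; field_simp [I_ne_zero],
      show (1 : ℂ) / 2 = ((1 / 2 : ℝ) : ℂ) by push_cast; rfl, ← ofReal_cpow (by positivity),
      ← Real.sqrt_eq_rpow, Real.sqrt_div hy.le, show (8 : ℝ) = 2 ^ 2 * 2 by norm_num,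
      Real.sqrt_mul (by positivity), Real.sqrt_sq (by norm_num)]
  simp_rw [cotKernel_I_mul]
  rw [hG, hsqrt, integral_complex_ofReal, integral_theta_mul_rpow hy]
  set J := ∫ ξ : ℝ, rexp (-2 * π * y * ξ ^ 2) *
        ((1 + rexp (-4 * π * y * ξ)) / (1 - rexp (-4 * π * y * ξ))) * ξ
  have hreal : √2 / (16 * π) * (4 * π * √y * J) = √y / (2 * √2) * J := by
    have h2 := Real.sq_sqrt (two_pos (α := ℝ)).le
    field_simp
    linear_combination 8 * J * h2
  rw [← ofReal_mul, ← hreal]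
  push_cast
  rw [← one_add_I_mul_I_mul_I_cpow]
  ring

/-- **Lemma 9.2**: for `τ` in the upper half-plane,
`((1+i)/(16π)) ∫₀^{i∞} θ(u) (τ+u)^{−3/2} du
  = (τ/(8i))^{1/2} ∫_ℝ e(ξ²τ) (1+e(2ξτ))/(1−e(2ξτ)) ξ dξ`,
where `∫₀^{i∞} f(u) du = i∫₀^∞ f(it) dt`; the left-hand integrand is integrable on `(0,∞)`
and the right-hand integrand is Lebesgue integrable on `ℝ`.  All complex powers are
principal-branch powers. -/
theorem theta_integral_identity (τ : ℂ) (hτ : 0 < τ.im) :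
    MeasureTheory.IntegrableOn
      (fun t : ℝ => theta (Complex.I * t) * (τ + Complex.I * t) ^ (-(3 : ℂ) / 2))
      (Set.Ioi 0) ∧
    MeasureTheory.Integrable
      (fun ξ : ℝ => ee ((ξ : ℂ) ^ 2 * τ) *
        ((1 + ee (2 * (ξ : ℂ) * τ)) / (1 - ee (2 * (ξ : ℂ) * τ))) * (ξ : ℂ)) ∧
    ((1 + Complex.I) / (16 * (π : ℂ))) *
        (Complex.I * ∫ t in Set.Ioi (0 : ℝ),
          theta (Complex.I * t) * (τ + Complex.I * t) ^ (-(3 : ℂ) / 2)) =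
      (τ / (8 * Complex.I)) ^ ((1 : ℂ) / 2) *
        ∫ ξ : ℝ, ee ((ξ : ℂ) ^ 2 * τ) *
          ((1 + ee (2 * (ξ : ℂ) * τ)) / (1 - ee (2 * (ξ : ℂ) * τ))) * (ξ : ℂ) := by
  change IntegrableOn (thetaKernel τ) (Set.Ioi 0) ∧ Integrable (cotKernel τ) ∧
    ((1 + I) / (16 * (π : ℂ))) * (I * ∫ t in Set.Ioi (0 : ℝ), thetaKernel τ t) =
      (τ / (8 * I)) ^ ((1 : ℂ) / 2) * ∫ ξ : ℝ, cotKernel τ ξ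
  refine ⟨integrableOn_thetaKernel hτ, integrable_cotKernel hτ, ?_⟩
  have hopen : IsOpen {z : ℂ | 0 < z.im} := isOpen_lt continuous_const continuous_im
  have hleft : DifferentiableOn ℂ (fun z => ((1 + I) / (16 * (π : ℂ))) *
      (I * ∫ t in Set.Ioi (0 : ℝ), thetaKernel z t)) {z : ℂ | 0 < z.im} :=
    (differentiableOn_integral_thetaKernel.const_mul I).const_mul _
  have hright : DifferentiableOn ℂ (fun z => (z / (8 * I)) ^ ((1 : ℂ) / 2) *
      ∫ ξ : ℝ, cotKernel z ξ) {z : ℂ | 0 < z.im} := by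
    refine DifferentiableOn.mul (fun z hz => ?_) differentiableOn_integral_cotKernel
    have hs : z / (8 * I) ∈ slitPlane := by
      refine Or.inl ?_
      have hz : 0 < z.im := hz
      rw [show z / (8 * I) = ((1 / 8 : ℝ) : ℂ) * (-I * z) by
        push_cast; field_simp [I_ne_zero]; linear_combination z * I_sq, re_ofReal_mul]
      simpa using hz
    exact ((differentiableAt_id.div_const _).cpow_const hs).differentiableWithinAt
  refine (hleft.analyticOnNhd hopen).eqOn_of_preconnected_of_frequently_eq (z₀ := I)
    (hright.analyticOnNhd hopen) (convex_halfSpace_im_gt 0).isPreconnected (by simp) ?_ hτ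
  have hlim : Tendsto (fun y : ℝ => I * (y : ℂ)) (𝓝[>] 1) (𝓝[≠] I) := by
    refine tendsto_nhdsWithin_iff.2 ⟨?_, eventually_nhdsWithin_of_forall fun y hy => ?_⟩
    · have : Continuous fun y : ℝ => I * (y : ℂ) := by fun_prop
      simpa using (this.tendsto 1).mono_left nhdsWithin_le_nhds
    · intro h
      have := congrArg Complex.im h
      simp at this
      exact (ne_of_gt hy) this
  refine hlim.frequently (Eventually.frequently ?_)
  filter_upwards [self_mem_nhdsWithin] with y hy
  exact integral_thetaKernel_I_mul (lt_trans one_pos hy)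

end
end
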